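/- arXiv:1908.07383 — 2 statements merged into one kernel-verified Lean document; each statement's English description precedes it below -/
import Mathlib

section
/- Let f(z) = 2z · exp(z² + exp(−1/z⁴)) for z ∈ ℂ* = ℂ \ {0}. Then f is a transcendental self-map of ℂ*; for every x ∈ ℝ \ {0} the orbit satisfies fⁿ(x) ∈ ℝ \ {0} and |fⁿ(x)| → ∞ as n → ∞, so ℝ \ {0} ⊆ I(f); and for every y ∈ ℝ \ {0} the point iy does not belong to I(f). Consequently I(f) is not connected, while I(f) ∪ {0,∞} ⊆ ℂ̂ is connected. -/
open Complex Topology Filter Set Function OnePoint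

noncomputable section

/-- The chordal (spherical) distance on the Riemann sphere, restricted to finite points. -/
def chordalDist (z w : ℂ) : ℝ :=
  ‖z - w‖ / Real.sqrt ((1 + ‖z‖ ^ 2) * (1 + ‖w‖ ^ 2))

/-- A transcendental self-map of `ℂ* = ℂ \ {0}`: a holomorphic self-map of the punctured
plane with essential singularities at `0` and `∞`; equivalently, on `ℂ*` it has the form
`z ^ m * exp (g z + h z⁻¹)` for some `m : ℤ` and nonconstant entire functions `g, h`. -/
def IsTranscendentalSelfMapCStar (f : ℂ → ℂ) : Prop :=
  ∃ (m : ℤ) (g h : ℂ → ℂ),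
    Differentiable ℂ g ∧ Differentiable ℂ h ∧
    (¬ ∃ c : ℂ, ∀ z, g z = c) ∧ (¬ ∃ c : ℂ, ∀ z, h z = c) ∧
    ∀ z : ℂ, z ≠ 0 → f z = z ^ m * Complex.exp (g z + h z⁻¹)

/-- The escaping set `I(f)` of a self-map of the punctured plane: points whose orbit
accumulates only at `0` and `∞`. -/
def escapingSet (f : ℂ → ℂ) : Set ℂ :=
  {z | z ≠ 0 ∧ ∀ ε : ℝ, 0 < ε → ∃ N : ℕ, ∀ n ≥ N,
    ‖f^[n] z‖ < ε ∨ 1 / ε < ‖f^[n] z‖}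

/-- The little escaping set `I_e(f)` with essential itinerary `e` (where `true` stands for the
symbol `∞` and `false` for the symbol `0`). -/
def littleEscapingSet (f : ℂ → ℂ) (e : ℕ → Bool) : Set ℂ :=
  {z | z ∈ escapingSet f ∧ ∃ ℓ k : ℕ, ∀ n : ℕ,
    (1 < ‖f^[n + ℓ] z‖ ↔ e (n + k) = true)}

/-- The immediate little escaping set `Ĩ_e(f)`. -/
def immediateLittleEscapingSet (f : ℂ → ℂ) (e : ℕ → Bool) : Set ℂ :=
  {z | z ∈ escapingSet f ∧ ∃ ℓ : ℕ, ∀ n : ℕ,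
    (1 < ‖f^[n + ℓ] z‖ ↔ e (n + ℓ) = true)}

/-- The Fatou set of a self-map of the punctured plane: points of `ℂ*` with a neighbourhood
(inside `ℂ*`) on which the family of iterates is equicontinuous w.r.t. the chordal metric. -/
def FatouSet (f : ℂ → ℂ) : Set ℂ :=
  {z | z ≠ 0 ∧ ∃ U : Set ℂ, IsOpen U ∧ z ∈ U ∧ (∀ w ∈ U, w ≠ 0) ∧
    ∀ w ∈ U, ∀ ε : ℝ, 0 < ε → ∃ δ : ℝ, 0 < δ ∧ ∀ w' ∈ U,
      chordalDist w w' < δ → ∀ n : ℕ, chordalDist (f^[n] w) (f^[n] w') < ε}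

/-- The Julia set `J(f) = ℂ* \ F(f)`. -/
def JuliaSet (f : ℂ → ℂ) : Set ℂ := {z : ℂ | z ≠ 0} \ FatouSet f

/-- A Fatou component: a connected component of the Fatou set. -/
def IsFatouComponent (f : ℂ → ℂ) (U : Set ℂ) : Prop :=
  ∃ z ∈ FatouSet f, U = connectedComponentIn (FatouSet f) z

/-- A wandering domain: a Fatou component `U` such that the Fatou components containing the
iterated images `fⁿ(U)` are pairwise distinct. -/
def IsWanderingDomain (f : ℂ → ℂ) (U : Set ℂ) : Prop :=
  IsFatouComponent f U ∧ ∃ V : ℕ → Set ℂ, V 0 = U ∧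
    (∀ n, IsFatouComponent f (V n)) ∧
    (∀ n, f '' V n ⊆ V (n + 1)) ∧ Function.Injective V

/-- A set is bounded in `ℂ*` if it lies in some closed annulus `{r ≤ |z| ≤ R}`. -/
def BoundedInCStar (X : Set ℂ) : Prop :=
  ∃ r R : ℝ, 0 < r ∧ r ≤ R ∧ X ⊆ {z : ℂ | r ≤ ‖z‖ ∧ ‖z‖ ≤ R}

/-- The boundary of a subset of `ℂ*` taken in `ℂ*`. -/
def boundaryInCStar (G : Set ℂ) : Set ℂ := frontier G \ {0}

/-- The set `I(f) ∪ {0, ∞}` regarded as a subset of the Riemann sphere `ℂ̂ = ℂ ∪ {∞}`. -/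
def escapingSphere (f : ℂ → ℂ) : Set (OnePoint ℂ) :=
  ((fun z : ℂ => (z : OnePoint ℂ)) '' escapingSet f) ∪ {((0 : ℂ) : OnePoint ℂ), ∞}

/-- The set `I_e(f) ∪ {0, ∞}` regarded as a subset of the Riemann sphere. -/
def littleEscapingSphere (f : ℂ → ℂ) (e : ℕ → Bool) : Set (OnePoint ℂ) :=
  ((fun z : ℂ => (z : OnePoint ℂ)) '' littleEscapingSet f e) ∪ {((0 : ℂ) : OnePoint ℂ), ∞}

/-- A subset of the sphere has exactly two connected components. -/
def HasExactlyTwoComponents (K : Set (OnePoint ℂ)) : Prop :=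
  ∃ x ∈ K, ∃ y ∈ K, connectedComponentIn K x ≠ connectedComponentIn K y ∧
    ∀ z ∈ K, connectedComponentIn K z = connectedComponentIn K x ∨
      connectedComponentIn K z = connectedComponentIn K y

/-- A domain `U ⊆ ℂ*` is doubly connected if its complement in the Riemann sphere has
exactly two connected components. -/
def DoublyConnected (U : Set ℂ) : Prop :=
  HasExactlyTwoComponents (((fun z : ℂ => (z : OnePoint ℂ)) '' U)ᶜ)

/-- A transcendental entire function. -/
def IsTranscendentalEntire (f : ℂ → ℂ) : Prop :=
  Differentiable ℂ f ∧ ¬ ∃ p : Polynomial ℂ, ∀ z, f z = p.eval z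

/-- The Fatou set of an entire function. -/
def FatouSetEntire (f : ℂ → ℂ) : Set ℂ :=
  {z | ∃ U : Set ℂ, IsOpen U ∧ z ∈ U ∧
    ∀ w ∈ U, ∀ ε : ℝ, 0 < ε → ∃ δ : ℝ, 0 < δ ∧ ∀ w' ∈ U,
      chordalDist w w' < δ → ∀ n : ℕ, chordalDist (f^[n] w) (f^[n] w') < ε}

/-- The Julia set of an entire function. -/
def JuliaSetEntire (f : ℂ → ℂ) : Set ℂ := (FatouSetEntire f)ᶜ

/-- `f` has a finite asymptotic value. -/
def HasFiniteAsymptoticValue (f : ℂ → ℂ) : Prop :=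
  ∃ (a : ℂ) (γ : ℝ → ℂ), ContinuousOn γ (Set.Ici (0 : ℝ)) ∧
    Tendsto (fun t => ‖γ t‖) atTop atTop ∧
    Tendsto (fun t => f (γ t)) atTop (nhds a)

/-- The mean value property for circles bounding closed discs contained in `G`. -/
def HasMeanValueOn (h : ℂ → ℝ) (G : Set ℂ) : Prop :=
  ∀ z r, 0 < r → Metric.closedBall z r ⊆ G →
    CircleIntegrable h z r ∧ Real.circleAverage h z r = h z

theorem HasMeanValueOn.add {h k : ℂ → ℝ} {G : Set ℂ} (hh : HasMeanValueOn h G)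
    (hk : HasMeanValueOn k G) : HasMeanValueOn (fun z => h z + k z) G := fun z r hr hz =>
  ⟨(hh z r hr hz).1.add (hk z r hr hz).1, by
    rw [Real.circleAverage_fun_add (hh z r hr hz).1 (hk z r hr hz).1, (hh z r hr hz).2,
      (hk z r hr hz).2]⟩

theorem HasMeanValueOn.sub {h k : ℂ → ℝ} {G : Set ℂ} (hh : HasMeanValueOn h G)
    (hk : HasMeanValueOn k G) : HasMeanValueOn (fun z => h z - k z) G := fun z r hr hz =>
  ⟨(hh z r hr hz).1.sub (hk z r hr hz).1, by
    rw [Real.circleAverage_fun_sub (hh z r hr hz).1 (hk z r hr hz).1, (hh z r hr hz).2,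
      (hk z r hr hz).2]⟩

theorem hasMeanValueOn_const (c : ℝ) (G : Set ℂ) : HasMeanValueOn (fun _ => c) G := fun z r _ _ =>
  ⟨circleIntegrable_const c z r, Real.circleAverage_const c z r⟩

theorem hasMeanValueOn_sum {ι : Type*} {h : ι → ℂ → ℝ} {G : Set ℂ} (s : Finset ι)
    (hh : ∀ i ∈ s, HasMeanValueOn (h i) G) : HasMeanValueOn (fun z => ∑ i ∈ s, h i z) G := by
  classical
  induction s using Finset.induction_on with
  | empty => simpa using hasMeanValueOn_const 0 G
  | insert a s ha ih =>
    simp only [Finset.sum_insert ha]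
    exact (hh a (Finset.mem_insert_self a s)).add
      (ih fun i hi => hh i (Finset.mem_insert_of_mem hi))

theorem hasMeanValueOn_log_norm {q : ℂ → ℂ} {G : Set ℂ} (hG : IsOpen G)
    (hq : DifferentiableOn ℂ q G) (hq0 : ∀ z ∈ G, q z ≠ 0) :
    HasMeanValueOn (fun z => Real.log ‖q z‖) G := by
  intro z r hr hz
  have han : AnalyticOnNhd ℂ q (Metric.closedBall z |r|) := by
    rw [abs_of_pos hr]; exact (hq.analyticOnNhd hG).mono hz
  refine ⟨ContinuousOn.circleIntegrable hr.le ?_, ?_⟩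
  · have hsub := Metric.sphere_subset_closedBall.trans hz
    exact ((hq.continuousOn.mono hsub).norm).log fun w hw => norm_ne_zero_iff.2 (hq0 w (hsub hw))
  · refine han.circleAverage_log_norm_of_ne_zero fun u hu => hq0 u (hz ?_)
    rwa [abs_of_pos hr] at hu

/-- The minimum principle for lower semicontinuous functions with the mean value property. -/
theorem HasMeanValueOn.exists_frontier_le {h : ℂ → ℝ} {G : Set ℂ} (hG : IsOpen G)
    (hGc : IsCompact (closure G)) (hls : LowerSemicontinuousOn h (closure G))
    (hmv : HasMeanValueOn h G) {z₀ : ℂ} (hz₀ : z₀ ∈ G) : ∃ ξ ∈ frontier G, h ξ ≤ h z₀ := by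
  obtain ⟨z₁, hz₁, hmin⟩ := LowerSemicontinuousOn.exists_isMinOn ⟨z₀, subset_closure hz₀⟩ hGc hls
  by_contra! hcon
  have hmin' : ∀ z ∈ closure G, h z₁ ≤ h z := fun z hz => hmin hz
  obtain ⟨z₂, hz₂, hmax⟩ := (hls.isCompact_inter_preimage_Iic hGc (h z₁)).exists_isMaxOn
    ⟨z₁, hz₁, le_refl (h z₁)⟩ Complex.continuous_re.continuousOn
  have hz₂v : h z₂ = h z₁ := le_antisymm hz₂.2 (hmin' _ hz₂.1)
  have hz₂G : z₂ ∈ G := by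
    by_contra hn
    have := hcon z₂ ⟨hz₂.1, by rwa [hG.interior_eq]⟩
    linarith [hmin' z₀ (subset_closure hz₀)]
  obtain ⟨r, hr, hball⟩ := Metric.nhds_basis_closedBall.mem_iff.1 (hG.mem_nhds hz₂G)
  obtain ⟨hint, havg⟩ := hmv z₂ r hr hball
  have hsph : ∀ t, circleMap z₂ r t ∈ closure G := fun t => subset_closure <|
    hball <| Metric.sphere_subset_closedBall <| circleMap_mem_sphere z₂ hr.le t
  have hpi := Real.pi_pos
  have hzero : ∫ t in (0 : ℝ)..2 * Real.pi, (h (circleMap z₂ r t) - h z₁) = 0 := by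
    rw [intervalIntegral.integral_sub hint (by simp)]
    rw [Real.circleAverage_def, smul_eq_mul, hz₂v] at havg
    simp only [intervalIntegral.integral_const, sub_zero, smul_eq_mul]
    rw [inv_mul_eq_iff_eq_mul₀ (by positivity)] at havg
    linarith
  rw [intervalIntegral.integral_eq_zero_iff_of_nonneg_ae
    (Eventually.of_forall fun t => sub_nonneg.2 (hmin' _ (hsph t)))
    (hint.sub (circleIntegrable_const (h z₁) z₂ r)),
    Set.Ioc_eq_empty (by linarith : ¬ 2 * Real.pi < 0), Set.union_empty] at hzero
  have hlt : ∀ t ∈ Set.Ioo (0 : ℝ) (Real.pi / 2), h (circleMap z₂ r t) - h z₁ ≠ 0 := by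
    intro t ht heq
    have hle : (circleMap z₂ r t).re ≤ z₂.re := hmax ⟨hsph t, (sub_eq_zero.1 heq).le⟩
    have hc := Real.cos_pos_of_mem_Ioo ⟨by linarith [ht.1], ht.2⟩
    simp only [circleMap, Complex.add_re, Complex.re_ofReal_mul, Complex.exp_ofReal_mul_I_re]
      at hle
    nlinarith [mul_pos hr hc]
  have hnull : MeasureTheory.volume (Set.Ioo (0 : ℝ) (Real.pi / 2)) = 0 := by
    rw [Filter.EventuallyEq, MeasureTheory.ae_restrict_iff' measurableSet_Ioc] at hzero
    refine MeasureTheory.measure_mono_null (fun t ht => ?_) hzero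
    exact fun hcontra => hlt t ht (hcontra ⟨ht.1, by linarith [ht.2]⟩)
  rw [Real.volume_Ioo, ENNReal.ofReal_eq_zero] at hnull
  linarith

/-- The kernel `log (|z - w̄| / |z - w|)` (the Green function of a half-plane) for `w ∈ U`,
extended by zero. -/
def reflectedKernel (U : Set ℂ) (z : ℂ) : ℂ → ℝ :=
  U.indicator fun w => Real.log (‖z - starRingEnd ℂ w‖ / ‖z - w‖)

theorem norm_sub_le_norm_sub_conj {z w : ℂ} (h : 0 < z.im * w.im) :
    ‖z - w‖ ≤ ‖z - starRingEnd ℂ w‖ := by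
  rw [← sq_le_sq₀ (norm_nonneg _) (norm_nonneg _), ← Complex.normSq_eq_norm_sq,
    ← Complex.normSq_eq_norm_sq, Complex.normSq_apply, Complex.normSq_apply]
  simp
  nlinarith

theorem sub_conj_ne_zero {z w : ℂ} (h : 0 < z.im * w.im) : z - starRingEnd ℂ w ≠ 0 := by
  intro h0
  have := congrArg Complex.im h0
  simp only [Complex.sub_im, Complex.conj_im, sub_neg_eq_add, Complex.zero_im] at this
  rw [eq_neg_of_add_eq_zero_right this] at h
  nlinarith [mul_self_nonneg z.im]

theorem reflectedKernel_nonneg {U : Set ℂ} {z : ℂ} (hz : ∀ w ∈ U, 0 < z.im * w.im) (w : ℂ) :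
    0 ≤ reflectedKernel U z w := by
  refine Set.indicator_nonneg (fun w hw => ?_) w
  rcases eq_or_ne z w with rfl | hne
  · simp
  · exact Real.log_nonneg <| (one_le_div (norm_pos_iff.2 (sub_ne_zero.2 hne))).2
      (norm_sub_le_norm_sub_conj (hz w hw))

theorem measurable_reflectedKernel {U : Set ℂ} (hU : IsOpen U) (z : ℂ) :
    Measurable (reflectedKernel U z) :=
  Measurable.indicator (Real.measurable_log.comp
    ((measurable_const.sub Complex.continuous_conj.measurable).norm.div
      (measurable_const.sub measurable_id).norm)) hU.measurableSet

theorem norm_sub_conj_comm (z w : ℂ) : ‖z - starRingEnd ℂ w‖ = ‖w - starRingEnd ℂ z‖ := by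
  rw [← Complex.norm_conj (z - starRingEnd ℂ w), map_sub, Complex.conj_conj, norm_sub_rev]

theorem circleIntegrable_reflectedKernel {U : Set ℂ} (hU : IsOpen U) {z : ℂ}
    (hz : ∀ w ∈ U, 0 < z.im * w.im) (ρ : ℝ) : CircleIntegrable (reflectedKernel U z) 0 ρ := by
  have h₁ : CircleIntegrable (fun w => Real.log ‖w - z‖) 0 ρ :=
    circleIntegrable_log_norm_sub_const ρ
  have h₂ : CircleIntegrable (fun w => Real.log ‖w - starRingEnd ℂ z‖) 0 ρ :=
    circleIntegrable_log_norm_sub_const ρ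
  refine (h₂.abs.add h₁.abs).mono_fun
    ((measurable_reflectedKernel hU z).comp (continuous_circleMap 0 ρ).measurable
      ).aestronglyMeasurable (Eventually.of_forall fun θ => ?_)
  set w := circleMap 0 ρ θ with hw
  simp only [Pi.abs_apply, Pi.add_apply, ← hw, Real.norm_eq_abs]
  rw [abs_of_nonneg (a := |_| + |_|) (add_nonneg (abs_nonneg _) (abs_nonneg _))]
  by_cases hwU : w ∈ U
  · rw [reflectedKernel, Set.indicator_of_mem hwU]
    rcases eq_or_ne z w with hzw | hne
    · simp [hzw]
    · rw [Real.log_div (norm_ne_zero_iff.2 (sub_conj_ne_zero (hz w hwU)))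
        (norm_ne_zero_iff.2 (sub_ne_zero.2 hne)), norm_sub_conj_comm, norm_sub_rev z w]
      exact abs_sub _ _
  · rw [reflectedKernel, Set.indicator_of_notMem hwU, abs_zero]
    positivity

theorem ae_circleMap_ne (z : ℂ) {ρ : ℝ} (hρ : ρ ≠ 0) :
    ∀ᵐ θ ∂(MeasureTheory.volume : MeasureTheory.Measure ℝ), circleMap 0 ρ θ ≠ z := by
  rw [MeasureTheory.ae_iff]
  simp only [not_not]
  exact ((Set.countable_singleton z).preimage_circleMap 0 hρ).measure_zero _

theorem lowerSemicontinuousOn_circleAverage_reflectedKernel {U K : Set ℂ} (hU : IsOpen U)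
    (hK : ∀ z ∈ K, ∀ w ∈ U, 0 < z.im * w.im) {ρ : ℝ} (hρ : ρ ≠ 0) :
    LowerSemicontinuousOn (fun z => Real.circleAverage (reflectedKernel U z) 0 ρ) K := by
  have hpi := Real.two_pi_pos
  set μ := (MeasureTheory.volume : MeasureTheory.Measure ℝ).restrict (Set.Ioc 0 (2 * Real.pi))
    with hμ
  have havg : ∀ z ∈ K, ENNReal.ofReal (2 * Real.pi * Real.circleAverage (reflectedKernel U z) 0 ρ)
      = ∫⁻ θ, ENNReal.ofReal (reflectedKernel U z (circleMap 0 ρ θ)) ∂μ := by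
    intro z hz
    rw [Real.circleAverage_def, smul_eq_mul, mul_inv_cancel_left₀ hpi.ne',
      intervalIntegral.integral_of_le hpi.le]
    refine MeasureTheory.ofReal_integral_eq_lintegral_ofReal ?_
      (Eventually.of_forall fun θ => reflectedKernel_nonneg (hK z hz) _)
    exact (intervalIntegrable_iff_integrableOn_Ioc_of_le hpi.le).1
      (circleIntegrable_reflectedKernel hU (hK z hz) ρ)
  intro z hz y hy
  rcases lt_or_ge y 0 with hy0 | hy0
  · filter_upwards [self_mem_nhdsWithin] with z' hz'
    exact hy0.trans_le (Real.circleAverage_nonneg_of_nonneg fun w _ =>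
      reflectedKernel_nonneg (hK z' hz') w)
  have hlim : ∀ᵐ θ ∂μ, ENNReal.ofReal (reflectedKernel U z (circleMap 0 ρ θ)) ≤
      liminf (fun z' => ENNReal.ofReal (reflectedKernel U z' (circleMap 0 ρ θ))) (𝓝[K] z) := by
    filter_upwards [MeasureTheory.ae_restrict_of_ae (ae_circleMap_ne z hρ)] with θ hθ
    have : (𝓝[K] z).NeBot := mem_closure_iff_nhdsWithin_neBot.1 (subset_closure hz)
    refine (Filter.Tendsto.liminf_eq ?_).ge
    refine (ENNReal.continuous_ofReal.tendsto _).comp (tendsto_nhdsWithin_of_tendsto_nhds ?_)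
    by_cases hw : circleMap 0 ρ θ ∈ U
    · simp only [reflectedKernel, Set.indicator_of_mem hw]
      have hne : ‖z - circleMap 0 ρ θ‖ ≠ 0 := norm_ne_zero_iff.2 (sub_ne_zero.2 hθ.symm)
      have hne' := norm_ne_zero_iff.2 (sub_conj_ne_zero (hK z hz _ hw))
      exact (((continuous_id.sub continuous_const).norm.continuousAt.div
        (continuous_id.sub continuous_const).norm.continuousAt hne).log
          (div_ne_zero hne' hne)).tendsto
    · simp only [reflectedKernel, Set.indicator_of_notMem hw]
      exact tendsto_const_nhds
  have hfatou : ENNReal.ofReal (2 * Real.pi * Real.circleAverage (reflectedKernel U z) 0 ρ) ≤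
      liminf (fun z' => ∫⁻ θ, ENNReal.ofReal (reflectedKernel U z' (circleMap 0 ρ θ)) ∂μ)
        (𝓝[K] z) := by
    rw [havg z hz]
    refine (MeasureTheory.lintegral_mono_ae hlim).trans (MeasureTheory.lintegral_liminf_le ?_)
    exact fun z' => ENNReal.measurable_ofReal.comp
      ((measurable_reflectedKernel hU z').comp (continuous_circleMap 0 ρ).measurable)
  have hlt : ENNReal.ofReal (2 * Real.pi * y) <
      ENNReal.ofReal (2 * Real.pi * Real.circleAverage (reflectedKernel U z) 0 ρ) :=
    (ENNReal.ofReal_lt_ofReal_iff_of_nonneg (by positivity)).2 (mul_lt_mul_of_pos_left hy hpi)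
  filter_upwards [eventually_lt_of_lt_liminf (hlt.trans_le hfatou), self_mem_nhdsWithin]
    with z' hz' hz'K
  rw [← havg z' hz'K, ENNReal.ofReal_lt_ofReal_iff_of_nonneg (by positivity)] at hz'
  exact lt_of_mul_lt_mul_left hz' hpi.le

theorem circleIntegrable_indicator_one {U : Set ℂ} (hU : IsOpen U) (ρ : ℝ) :
    CircleIntegrable (U.indicator (1 : ℂ → ℝ)) 0 ρ := by
  refine (circleIntegrable_const (1 : ℝ) 0 ρ).mono_fun
    ((measurable_one.indicator hU.measurableSet).comp
      (continuous_circleMap 0 ρ).measurable).aestronglyMeasurable (Eventually.of_forall fun θ => ?_)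
  by_cases hw : circleMap 0 ρ θ ∈ U <;> simp [hw]

theorem circleAverage_reflectedKernel_le {U : Set ℂ} (hU : IsOpen U) {z : ℂ}
    (hz : ∀ w ∈ U, 0 < z.im * w.im) {ρ : ℝ} (hρ : 0 < ρ) (h : 2 * ρ ≤ ‖z‖ ∨ 2 * ‖z‖ ≤ ρ) :
    Real.circleAverage (reflectedKernel U z) 0 ρ ≤
      Real.log 3 * Real.circleAverage (U.indicator 1) 0 ρ := by
  rw [← smul_eq_mul, ← Real.circleAverage_fun_smul]
  refine Real.circleAverage_mono (circleIntegrable_reflectedKernel hU hz ρ)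
    ((circleIntegrable_indicator_one hU ρ).const_fun_smul) fun w hw => ?_
  rw [abs_of_pos hρ, mem_sphere_zero_iff_norm] at hw
  by_cases hwU : w ∈ U
  · simp only [reflectedKernel, Set.indicator_of_mem hwU, Pi.one_apply, smul_eq_mul, mul_one]
    have h₁ : ‖z - starRingEnd ℂ w‖ ≤ ‖z‖ + ρ := by
      simpa [hw] using norm_sub_le z (starRingEnd ℂ w)
    have h₂ : ‖z‖ + ρ ≤ 3 * ‖z - w‖ := by
      have h₃ := norm_sub_norm_le z w
      have h₄ := norm_sub_norm_le w z
      rw [norm_sub_rev w z] at h₄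
      rcases h with h | h <;> linarith
    have hpos := norm_pos_iff.2 (sub_conj_ne_zero (hz w hwU))
    have hpos' : 0 < ‖z - w‖ := by linarith [norm_nonneg z]
    refine Real.log_le_log (div_pos hpos hpos') ?_
    rw [div_le_iff₀ hpos']
    linarith
  · simp [reflectedKernel, Set.indicator_of_notMem hwU]

open Classical in
/-- Complex conjugation on `U`, and the identity elsewhere. -/
def reflectIn (U : Set ℂ) (w : ℂ) : ℂ := if w ∈ U then starRingEnd ℂ w else w

theorem measurable_reflectIn {U : Set ℂ} (hU : IsOpen U) : Measurable (reflectIn U) :=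
  Measurable.ite hU.measurableSet Complex.continuous_conj.measurable measurable_id

theorem reflectIn_notMem {U : Set ℂ} (hUim : ∀ z ∈ U, ∀ w ∈ U, 0 < z.im * w.im) (w : ℂ) :
    reflectIn U w ∉ U := by
  rw [reflectIn]
  split_ifs with hw
  · intro hw'
    have := hUim w hw _ hw'
    rw [Complex.conj_im] at this
    nlinarith [mul_self_nonneg w.im]
  · exact hw

theorem norm_reflectIn (U : Set ℂ) (w : ℂ) : ‖reflectIn U w‖ = ‖w‖ := by
  rw [reflectIn]
  split_ifs <;> simp

theorem circleAverage_log_norm_sub_reflectIn {U : Set ℂ} (hU : IsOpen U) {z : ℂ}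
    (hz : ∀ w ∈ U, 0 < z.im * w.im) {ρ : ℝ} (hρ : ρ ≠ 0) :
    Real.circleAverage (fun w => Real.log ‖z - reflectIn U w‖) 0 ρ =
      Real.log ρ + Real.posLog (ρ⁻¹ * ‖z‖) + Real.circleAverage (reflectedKernel U z) 0 ρ := by
  have h₁ := circleAverage_log_norm_sub_const_eq_log_radius_add_posLog (a := z) (c := 0) hρ
  rw [zero_sub, norm_neg] at h₁
  rw [← h₁, ← Real.circleAverage_fun_add (circleIntegrable_log_norm_sub_const ρ)
    (circleIntegrable_reflectedKernel hU hz ρ), Real.circleAverage_def, Real.circleAverage_def]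
  congr 1
  refine intervalIntegral.integral_congr_ae ?_
  filter_upwards [ae_circleMap_ne z hρ] with θ hθ _
  have hne : ‖z - circleMap 0 ρ θ‖ ≠ 0 := norm_ne_zero_iff.2 (sub_ne_zero.2 hθ.symm)
  rw [norm_sub_rev _ z]
  by_cases hw : circleMap 0 ρ θ ∈ U
  · rw [reflectIn, if_pos hw, reflectedKernel, Set.indicator_of_mem hw,
      Real.log_div (norm_ne_zero_iff.2 (sub_conj_ne_zero (hz _ hw))) hne]
    ring
  · rw [reflectIn, if_neg hw, reflectedKernel, Set.indicator_of_notMem hw, add_zero]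

theorem hasMeanValueOn_circleAverage_log {q : ℂ → ℂ} {G U : Set ℂ} (hG : IsOpen G)
    (hU : IsOpen U) (hUim : ∀ z ∈ U, ∀ w ∈ U, 0 < z.im * w.im)
    (hq : DifferentiableOn ℂ q G) (hqU : Set.MapsTo q G U) (ρ : ℝ) :
    HasMeanValueOn (fun z => Real.circleAverage (fun w => Real.log ‖q z - reflectIn U w‖) 0 ρ)
      G := by
  intro c r hr hball
  have hpi := Real.two_pi_pos
  set μ := (MeasureTheory.volume : MeasureTheory.Measure ℝ).restrict (Set.Ioc 0 (2 * Real.pi))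
    with hμ
  set F : ℝ → ℝ → ℝ := fun θ φ =>
    Real.log ‖q (circleMap c r θ) - reflectIn U (circleMap 0 ρ φ)‖ with hF
  have hKc : IsCompact (q '' Metric.closedBall c r) :=
    (isCompact_closedBall c r).image_of_continuousOn (hq.continuousOn.mono hball)
  obtain ⟨δ, hδ, hδU⟩ := hKc.exists_cthickening_subset_open hU
    (Set.image_subset_iff.2 fun z hz => hqU (hball hz))
  obtain ⟨M, hM⟩ := hKc.isBounded.exists_norm_le
  have hsph : ∀ θ, circleMap c r θ ∈ Metric.closedBall c r := fun θ =>
    Metric.sphere_subset_closedBall (circleMap_mem_sphere c hr.le θ)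
  have hlow : ∀ z ∈ Metric.closedBall c r, ∀ w, δ ≤ ‖q z - reflectIn U w‖ := by
    intro z hz w
    by_contra! hlt
    refine reflectIn_notMem hUim w (hδU (Metric.mem_cthickening_of_dist_le _ (q z) δ _
      (Set.mem_image_of_mem q hz) ?_))
    rw [dist_comm, dist_eq_norm]
    exact hlt.le
  have hFm : Measurable (Function.uncurry F) := by
    have hqm : Measurable fun θ => q (circleMap c r θ) :=
      (hq.continuousOn.comp_continuous (continuous_circleMap c r)
        fun θ => hball (hsph θ)).measurable
    exact Real.measurable_log.comp ((hqm.comp measurable_fst).sub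
      ((measurable_reflectIn hU).comp
        ((continuous_circleMap 0 ρ).measurable.comp measurable_snd))).norm
  have hFi : MeasureTheory.Integrable (Function.uncurry F) (μ.prod μ) := by
    refine MeasureTheory.Integrable.of_bound hFm.aestronglyMeasurable
      (|Real.log δ| + |Real.log (M + |ρ|)|) (Eventually.of_forall fun p => ?_)
    have h₁ := hlow _ (hsph p.1) (circleMap 0 ρ p.2)
    have h₂ : ‖q (circleMap c r p.1) - reflectIn U (circleMap 0 ρ p.2)‖ ≤ M + |ρ| := by
      refine (norm_sub_le _ _).trans (add_le_add (hM _ (Set.mem_image_of_mem q (hsph p.1))) ?_)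
      rw [norm_reflectIn, norm_circleMap_zero]
    have h₃ := Real.log_le_log hδ h₁
    have h₄ := Real.log_le_log (hδ.trans_le h₁) h₂
    simp only [Function.uncurry, hF, Real.norm_eq_abs, abs_le]
    constructor
    · linarith [neg_abs_le (Real.log δ), abs_nonneg (Real.log (M + |ρ|))]
    · linarith [le_abs_self (Real.log (M + |ρ|)), abs_nonneg (Real.log δ)]
  have hout : ∀ z, Real.circleAverage (fun w => Real.log ‖q z - reflectIn U w‖) 0 ρ =
      (2 * Real.pi)⁻¹ * ∫ φ, Real.log ‖q z - reflectIn U (circleMap 0 ρ φ)‖ ∂μ := fun z => by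
    rw [Real.circleAverage_def, smul_eq_mul, intervalIntegral.integral_of_le hpi.le]
  refine ⟨?_, ?_⟩
  · rw [CircleIntegrable, intervalIntegrable_iff_integrableOn_Ioc_of_le hpi.le]
    simp only [hout]
    exact hFi.integral_prod_left.const_mul _
  · rw [Real.circleAverage_def, smul_eq_mul, intervalIntegral.integral_of_le hpi.le]
    simp only [hout]
    rw [MeasureTheory.integral_const_mul]
    congr 1
    rw [MeasureTheory.integral_integral_swap hFi, ← MeasureTheory.integral_const_mul]
    refine MeasureTheory.integral_congr_ae (Eventually.of_forall fun φ => ?_)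
    set w := reflectIn U (circleMap 0 ρ φ)
    have hmv := (hasMeanValueOn_log_norm (q := fun z => q z - w) hG (hq.sub_const w)
      (fun z hz h0 => reflectIn_notMem hUim (circleMap 0 ρ φ)
        ((sub_eq_zero.1 h0 : q z = w) ▸ hqU hz : w ∈ U)) c r hr hball).2
    rwa [Real.circleAverage_def, smul_eq_mul, intervalIntegral.integral_of_le hpi.le] at hmv

/-- A nonnegative function on `closure G` which is small at `z₀` and forces `q` to be close to
`0` or `∞` wherever it is less than `1`. -/
theorem exists_barrier {q : ℂ → ℂ} {G : Set ℂ} (hG : IsOpen G) (hqc : ContinuousOn q (closure G))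
    (hqd : DifferentiableOn ℂ q G) (hq0 : ∀ ξ ∈ closure G, q ξ ≠ 0) (hU : IsOpen (q '' G))
    (him : ∀ ξ ∈ closure G, ∀ w ∈ q '' G, 0 < (q ξ).im * w.im) {z₀ : ℂ} (hz₀ : z₀ ∈ G) {R : ℝ}
    (hR : 0 < R)
    (hz₀R : 2 * (Real.exp 1 * R) ≤ ‖q z₀‖ ∨ 2 * ‖q z₀‖ ≤ (Real.exp 1 * R)⁻¹) :
    ∃ h : ℂ → ℝ, LowerSemicontinuousOn h (closure G) ∧ HasMeanValueOn h G ∧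
      (∀ ξ ∈ closure G, 0 ≤ h ξ) ∧
      h z₀ ≤ Real.log 3 * (Real.circleAverage ((q '' G).indicator 1) 0 (Real.exp 1 * R) +
        Real.circleAverage ((q '' G).indicator 1) 0 (Real.exp 1 * R)⁻¹) ∧
      ∀ ξ ∈ closure G, h ξ < 1 → R < ‖q ξ‖ ∨ ‖q ξ‖ < R⁻¹ := by
  set U := q '' G with hUdef
  have hlog3 : 0 ≤ Real.log 3 := Real.log_nonneg (by norm_num)
  have hUim : ∀ z ∈ U, ∀ w ∈ U, 0 < z.im * w.im := by
    rintro _ ⟨ξ, hξ, rfl⟩ w hw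
    exact him ξ (subset_closure hξ) w hw
  have hA : ∀ ρ : ℝ, (0 : ℝ) ≤ Real.circleAverage (U.indicator 1) 0 ρ := fun ρ =>
    Real.circleAverage_nonneg_of_nonneg fun w _ =>
      Set.indicator_nonneg (fun _ _ => zero_le_one) w
  set E : ℝ → ℂ → ℝ := fun ρ ξ => Real.circleAverage (reflectedKernel U (q ξ)) 0 ρ with hE
  have hE0 : ∀ ρ, ∀ ξ ∈ closure G, 0 ≤ E ρ ξ := fun ρ ξ hξ =>
    Real.circleAverage_nonneg_of_nonneg fun w _ => reflectedKernel_nonneg (him ξ hξ) w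
  have hEls : ∀ ρ, ρ ≠ 0 → LowerSemicontinuousOn (E ρ) (closure G) := by
    intro ρ hρ
    exact (lowerSemicontinuousOn_circleAverage_reflectedKernel (K := q '' closure G) hU
      (Set.forall_mem_image.2 him) hρ).comp hqc (Set.mapsTo_image q _)
  have hmv : ∀ ρ, ρ ≠ 0 → HasMeanValueOn
      (fun ξ => Real.log ρ + Real.posLog (ρ⁻¹ * ‖q ξ‖) + E ρ ξ) G := by
    intro ρ hρ c r hr hball
    have hc : c ∈ G := hball (Metric.mem_closedBall_self hr.le)
    have h := hasMeanValueOn_circleAverage_log hG hU hUim hqd (Set.mapsTo_image q G) ρ c r hr hball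
    have heq : Set.EqOn
        (fun z => Real.circleAverage (fun w => Real.log ‖q z - reflectIn U w‖) 0 ρ)
        (fun ξ => Real.log ρ + Real.posLog (ρ⁻¹ * ‖q ξ‖) + E ρ ξ) G := fun ξ hξ =>
      circleAverage_log_norm_sub_reflectIn hU (him ξ (subset_closure hξ)) hρ
    have heq' := heq.mono (Metric.sphere_subset_closedBall.trans hball)
    rw [← abs_of_pos hr] at heq'
    refine ⟨(circleIntegrable_congr heq').1 h.1, ?_⟩
    rw [← Real.circleAverage_congr_sphere heq', h.2]
    exact heq hc
  have hposc : ∀ ρ : ℝ, ContinuousOn (fun ξ => Real.posLog (ρ⁻¹ * ‖q ξ‖)) (closure G) :=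
    fun ρ => Real.continuous_posLog.comp_continuousOn (continuousOn_const.mul hqc.norm)
  have hposlog : ∀ ρ : ℝ, 0 < ρ → ∀ ξ ∈ closure G,
      Real.log ‖q ξ‖ - Real.log ρ ≤ Real.posLog (ρ⁻¹ * ‖q ξ‖) := by
    intro ρ hρ ξ hξ
    rw [← Real.log_div (norm_ne_zero_iff.2 (hq0 ξ hξ)) hρ.ne', div_eq_inv_mul]
    exact le_max_right _ _
  have heR : 0 < Real.exp 1 * R := by positivity
  have hlogeR : Real.log (Real.exp 1 * R) = 1 + Real.log R := by
    rw [Real.log_mul (Real.exp_pos 1).ne' hR.ne', Real.log_exp]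
  rcases hz₀R with hz₀R | hz₀R
  · set ρ := Real.exp 1 * R
    refine ⟨fun ξ => Real.log ρ + Real.posLog (ρ⁻¹ * ‖q ξ‖) + E ρ ξ - Real.log ‖q ξ‖,
      ?_, (hmv ρ heR.ne').sub (hasMeanValueOn_log_norm hG hqd
        fun z hz => hq0 z (subset_closure hz)), fun ξ hξ => ?_, ?_, fun ξ hξ hlt => ?_⟩
    · have hc : ContinuousOn (fun ξ => Real.log ρ + Real.posLog (ρ⁻¹ * ‖q ξ‖) - Real.log ‖q ξ‖)
          (closure G) := (continuousOn_const.add (hposc ρ)).sub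
            (hqc.norm.log fun ξ hξ => norm_ne_zero_iff.2 (hq0 ξ hξ))
      refine (congrArg (LowerSemicontinuousOn · (closure G)) (funext fun ξ => ?_)).mp
        (hc.lowerSemicontinuousOn.add (hEls ρ heR.ne'))
      ring
    · linarith [hposlog ρ heR ξ hξ, hE0 ρ ξ hξ]
    · have h₁ := circleAverage_reflectedKernel_le hU (him z₀ (subset_closure hz₀)) heR
        (Or.inl hz₀R)
      have h₂ : Real.posLog (ρ⁻¹ * ‖q z₀‖) = Real.log ‖q z₀‖ - Real.log ρ := by
        rw [← Real.log_div (by linarith) heR.ne', div_eq_inv_mul]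
        refine Real.posLog_eq_log ?_
        rw [abs_of_nonneg (by positivity), inv_mul_eq_div, one_le_div heR]
        linarith
      have h₃ := mul_nonneg hlog3 (hA ρ⁻¹)
      simp only [h₂, hE]
      linarith
    · left
      have h₁ : 0 ≤ Real.posLog (ρ⁻¹ * ‖q ξ‖) := Real.posLog_nonneg
      rw [← Real.log_lt_log_iff hR (norm_pos_iff.2 (hq0 ξ hξ))]
      linarith [hE0 ρ ξ hξ]
  · have hρ : 0 < (Real.exp 1 * R)⁻¹ := inv_pos.2 heR
    have hlogρ : Real.log (Real.exp 1 * R)⁻¹ = - (1 + Real.log R) := by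
      rw [Real.log_inv, hlogeR]
    have hA' := hA (Real.exp 1 * R)
    set ρ := (Real.exp 1 * R)⁻¹
    refine ⟨fun ξ => Real.log ρ + Real.posLog (ρ⁻¹ * ‖q ξ‖) + E ρ ξ - Real.log ρ,
      ?_, (hmv ρ hρ.ne').sub (hasMeanValueOn_const _ G), fun ξ hξ => ?_, ?_, fun ξ hξ hlt => ?_⟩
    · refine (congrArg (LowerSemicontinuousOn · (closure G)) (funext fun ξ => ?_)).mp
        ((hposc ρ).lowerSemicontinuousOn.add (hEls ρ hρ.ne'))
      ring
    · have h₁ : 0 ≤ Real.posLog (ρ⁻¹ * ‖q ξ‖) := Real.posLog_nonneg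
      linarith [hE0 ρ ξ hξ]
    · have h₁ := circleAverage_reflectedKernel_le hU (him z₀ (subset_closure hz₀)) hρ
        (Or.inr hz₀R)
      have h₂ : Real.posLog (ρ⁻¹ * ‖q z₀‖) = 0 := by
        rw [Real.posLog_eq_zero_iff, abs_of_nonneg (by positivity), inv_mul_eq_div,
          div_le_one hρ]
        linarith [norm_nonneg (q z₀)]
      have h₃ := mul_nonneg hlog3 hA'
      simp only [h₂, hE]
      linarith
    · right
      rw [← Real.log_lt_log_iff (norm_pos_iff.2 (hq0 ξ hξ)) (inv_pos.2 hR), Real.log_inv]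
      linarith [hE0 ρ ξ hξ, hposlog ρ hρ ξ hξ]

theorem IsPreconnected.im_mul_im_pos {s : Set ℂ} (hs : IsPreconnected s)
    (him : ∀ z ∈ s, z.im ≠ 0) : ∀ z ∈ s, ∀ w ∈ s, 0 < z.im * w.im := by
  have key : ∀ z ∈ s, ∀ w ∈ s, z.im < 0 → ¬ 0 < w.im := fun z hz w hw h₁ h₂ => by
    obtain ⟨u, hu, hu0⟩ := hs.intermediate_value hz hw Complex.continuous_im.continuousOn
      ⟨h₁.le, h₂.le⟩
    exact him u hu hu0
  intro z hz w hw
  rcases (him z hz).lt_or_gt with h₁ | h₁ <;> rcases (him w hw).lt_or_gt with h₂ | h₂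
  · exact mul_pos_of_neg_of_neg h₁ h₂
  · exact absurd h₂ (key z hz w hw h₁)
  · exact absurd h₁ (key w hw z hz h₂)
  · exact mul_pos h₁ h₂

theorem frontier_nonempty_of_isCompact_closure {G : Set ℂ} (hGc : IsCompact (closure G))
    (hne : G.Nonempty) : (frontier G).Nonempty := by
  refine nonempty_frontier_iff.2 ⟨hne, ?_⟩
  rintro rfl
  rw [closure_univ] at hGc
  exact noncompact_univ ℂ hGc

theorem isOpen_image_of_frontier_notMem {q : ℂ → ℂ} {G S : Set ℂ} (hG : IsOpen G)
    (hGp : IsPreconnected G) (hGc : IsCompact (closure G)) (hqc : ContinuousOn q (closure G))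
    (hqd : DifferentiableOn ℂ q G) (hfr : ∀ ξ ∈ frontier G, q ξ ∉ S) {z₀ : ℂ} (hz₀ : z₀ ∈ G)
    (hqz₀ : q z₀ ∈ S) : IsOpen (q '' G) := by
  rcases (hqd.analyticOnNhd hG).is_constant_or_isOpen hGp with ⟨c, hc⟩ | h
  · obtain ⟨ξ, hξ⟩ := frontier_nonempty_of_isCompact_closure hGc ⟨z₀, hz₀⟩
    have hcl : Set.EqOn q (fun _ => c) (closure G) :=
      Set.EqOn.of_subset_closure hc hqc continuousOn_const subset_closure subset_rfl
    refine absurd ?_ (hfr ξ hξ)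
    rw [hcl hξ.1]
    exact hc z₀ hz₀ ▸ hqz₀
  · exact h G subset_rfl hG

/-- If `q` omits the nonzero reals on the boundary of a bounded domain, and is nonvanishing, then
it omits the reals on the domain. -/
theorem im_ne_zero_of_frontier {q : ℂ → ℂ} {G : Set ℂ} (hGc : IsCompact (closure G))
    (hqc : ContinuousOn q (closure G)) (hq0 : ∀ ξ ∈ closure G, q ξ ≠ 0) (hU : IsOpen (q '' G))
    (hG : IsOpen G) (hfr : ∀ ξ ∈ frontier G, (q ξ).im ≠ 0) : ∀ ξ ∈ closure G, (q ξ).im ≠ 0 := by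
  intro ξ hξ hξ0
  have hT : IsCompact (closure G ∩ (fun z => (q z).im) ⁻¹' {0}) :=
    hGc.of_isClosed_subset
      ((Complex.continuous_im.comp_continuousOn hqc).preimage_isClosed_of_isClosed
        isClosed_closure isClosed_singleton) Set.inter_subset_left
  obtain ⟨z, ⟨hz, hz0⟩, hmax⟩ := hT.exists_isMaxOn ⟨ξ, hξ, hξ0⟩
    (hqc.norm.mono Set.inter_subset_left)
  have hzG : z ∈ G := by
    by_contra hn
    exact hfr z ⟨hz, by rwa [hG.interior_eq]⟩ hz0
  have hcont : ContinuousAt (fun t : ℝ => ((1 + t : ℝ) : ℂ) * q z) 0 := by fun_prop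
  have hev : ∀ᶠ t : ℝ in 𝓝[>] 0, ((1 + t : ℝ) : ℂ) * q z ∈ q '' G :=
    (hcont.eventually_mem (hU.mem_nhds (by simpa using ⟨z, hzG, rfl⟩))).filter_mono
      nhdsWithin_le_nhds
  obtain ⟨t, ⟨y, hy, hyt⟩, ht⟩ := (hev.and self_mem_nhdsWithin).exists
  have ht0 : (0 : ℝ) < t := ht
  have hyT : y ∈ closure G ∩ (fun z => (q z).im) ⁻¹' {0} := by
    refine ⟨subset_closure hy, ?_⟩
    have hz0' : (q z).im = 0 := hz0
    simp only [Set.mem_preimage, Set.mem_singleton_iff, hyt, Complex.im_ofReal_mul, hz0', mul_zero]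
  have hle : ‖q y‖ ≤ ‖q z‖ := hmax hyT
  rw [hyt, norm_mul, Complex.norm_real, Real.norm_of_nonneg (by linarith)] at hle
  nlinarith [norm_pos_iff.2 (hq0 z hz)]

/-- A Harnack-type inequality for functions with values in a half-plane. -/
theorem norm_le_three_mul_norm {q : ℂ → ℂ} {c : ℂ} {r : ℝ} (hr : 0 < r)
    (hq : DifferentiableOn ℂ q (Metric.ball c r))
    (him : ∀ z ∈ Metric.ball c r, 0 < (q c).im * (q z).im) {z : ℂ}
    (hz : z ∈ Metric.ball c (r / 2)) : ‖q z‖ ≤ 3 * ‖q c‖ ∧ ‖q c‖ ≤ 3 * ‖q z‖ := by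
  have hden : ∀ z ∈ Metric.ball c r, q z - starRingEnd ℂ (q c) ≠ 0 := fun z hz =>
    sub_conj_ne_zero (by rw [mul_comm]; exact him z hz)
  set h : ℂ → ℂ := fun z => (q z - q c) / (q z - starRingEnd ℂ (q c)) with hh
  have hd : DifferentiableOn ℂ h (Metric.ball c r) :=
    (hq.sub_const _).div (hq.sub_const _) hden
  have hc : h c = 0 := by simp [hh]
  have hmaps : Set.MapsTo h (Metric.ball c r) (Metric.closedBall (h c) 1) := by
    intro z hz
    rw [hc, mem_closedBall_zero_iff, hh, norm_div, div_le_one (norm_pos_iff.2 (hden z hz))]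
    exact norm_sub_le_norm_sub_conj (by rw [mul_comm]; exact him z hz)
  have hzr : z ∈ Metric.ball c r := Metric.ball_subset_ball (by linarith) hz
  have key := Complex.dist_le_div_mul_dist_of_mapsTo_ball hd hmaps hzr
  have hle : ‖q z - q c‖ ≤ 1 / 2 * ‖q z - starRingEnd ℂ (q c)‖ := by
    rw [hc, dist_zero_right, hh, norm_div, div_le_iff₀ (norm_pos_iff.2 (hden z hzr))] at key
    refine key.trans (mul_le_mul_of_nonneg_right ?_ (norm_nonneg _))
    rw [div_mul_eq_mul_div, one_mul, div_le_iff₀ hr]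
    linarith [Metric.mem_ball.1 hz]
  have h₁ : ‖q z - starRingEnd ℂ (q c)‖ ≤ ‖q z‖ + ‖q c‖ := by
    simpa using norm_sub_le (q z) (starRingEnd ℂ (q c))
  have h₂ := norm_sub_norm_le (q z) (q c)
  have h₃ := norm_sub_norm_le (q c) (q z)
  rw [norm_sub_rev] at h₃
  constructor <;> linarith

theorem summable_circleAverage_indicator {U : ℕ → Set ℂ} (hU : ∀ n, IsOpen (U n))
    (hd : Pairwise (Function.onFun Disjoint U)) (ρ : ℝ) :
    Summable fun n => Real.circleAverage ((U n).indicator (1 : ℂ → ℝ)) 0 ρ := by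
  refine summable_of_sum_le (c := 1) (fun n => Real.circleAverage_nonneg_of_nonneg fun w _ =>
    Set.indicator_nonneg (fun _ _ => zero_le_one) w) fun s => ?_
  rw [← Real.circleAverage_sum fun n _ => circleIntegrable_indicator_one (hU n) ρ]
  refine Real.circleAverage_mono_on_of_le_circle
    (CircleIntegrable.sum s fun n _ => circleIntegrable_indicator_one (hU n) ρ) fun w _ => ?_
  rw [Finset.sum_apply, ← Finset.indicator_biUnion_apply s U fun i _ j _ hij => hd hij]
  exact Set.indicator_le_self' (fun _ _ => zero_le_one) w

theorem mapsTo_iterate_compl_zero {f : ℂ → ℂ} (hf0 : Set.MapsTo f {0}ᶜ {0}ᶜ) (n : ℕ) {z : ℂ}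
    (hz : z ≠ 0) : f^[n] z ≠ 0 :=
  hf0.iterate n hz

theorem iterate_mem_escapingSet_iff {f : ℂ → ℂ} (hf0 : Set.MapsTo f {0}ᶜ {0}ᶜ) (n : ℕ) {z : ℂ}
    (hz : z ≠ 0) : f^[n] z ∈ escapingSet f ↔ z ∈ escapingSet f := by
  refine ⟨fun h => ⟨hz, fun ε hε => ?_⟩, fun h => ⟨mapsTo_iterate_compl_zero hf0 n hz,
    fun ε hε => ?_⟩⟩
  · obtain ⟨N, hN⟩ := h.2 ε hε
    refine ⟨N + n, fun m hm => ?_⟩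
    have := hN (m - n) (by omega)
    rwa [← Function.iterate_add_apply, Nat.sub_add_cancel (by omega)] at this
  · obtain ⟨N, hN⟩ := h.2 ε hε
    refine ⟨N, fun m hm => ?_⟩
    rw [← Function.iterate_add_apply]
    exact hN (m + n) (by omega)

theorem mem_escapingSet_of_norm_le {f : ℂ → ℂ} {z c : ℂ} (hz : z ≠ 0)
    (h : ∀ n, ‖f^[n] z‖ ≤ 3 * ‖f^[n] c‖ ∧ ‖f^[n] c‖ ≤ 3 * ‖f^[n] z‖) (hc : c ∈ escapingSet f) :
    z ∈ escapingSet f := by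
  refine ⟨hz, fun ε hε => ?_⟩
  obtain ⟨N, hN⟩ := hc.2 (ε / 3) (by positivity)
  refine ⟨N, fun n hn => (hN n hn).imp (fun h' => ?_) fun h' => ?_⟩
  · linarith [(h n).1]
  · rw [one_div_div, div_eq_mul_one_div] at h'
    linarith [(h n).2]

/-- An escaping orbit leaves every compact subset of the punctured plane. -/
theorem exists_iterate_notMem_of_isCompact {f : ℂ → ℂ} {z : ℂ} (hz : z ∈ escapingSet f)
    {K : Set ℂ} (hK : IsCompact K) (h0 : (0 : ℂ) ∉ K) : ∃ N, ∀ n ≥ N, f^[n] z ∉ K := by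
  obtain ⟨δ, hδ, hball⟩ := Metric.mem_nhds_iff.1 (hK.isClosed.isOpen_compl.mem_nhds h0)
  obtain ⟨M, hM, hMK⟩ := hK.isBounded.exists_pos_norm_le
  obtain ⟨N, hN⟩ := hz.2 (min δ (1 / M)) (by positivity)
  refine ⟨N, fun n hn hmem => (hN n hn).elim (fun h => ?_) fun h => ?_⟩
  · exact hball (by simpa using h.trans_le (min_le_left _ _)) hmem
  · have h₁ : M ≤ 1 / min δ (1 / M) := by
      rw [le_one_div hM (by positivity)]
      exact min_le_right _ _
    linarith [hMK _ hmem]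

section

variable {f : ℂ → ℂ} {G : Set ℂ}

theorem continuousOn_iterate_closure (hfd : DifferentiableOn ℂ f {0}ᶜ)
    (hf0 : Set.MapsTo f {0}ᶜ {0}ᶜ) (h0 : (0 : ℂ) ∉ closure G) (n : ℕ) :
    ContinuousOn f^[n] (closure G) :=
  (hfd.iterate hf0 n).continuousOn.mono fun _ hz hz0 => h0 (hz0 ▸ hz)

theorem isOpen_iterate_image (hfd : DifferentiableOn ℂ f {0}ᶜ)
    (hf0 : Set.MapsTo f {0}ᶜ {0}ᶜ) (hG : IsOpen G) (hGp : IsPreconnected G)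
    (hGc : IsCompact (closure G)) (h0 : (0 : ℂ) ∉ closure G)
    (hfr : ∀ ξ ∈ frontier G, ξ ∉ escapingSet f) {z₀ : ℂ} (hz₀ : z₀ ∈ G)
    (hz₀I : z₀ ∈ escapingSet f) (n : ℕ) : IsOpen (f^[n] '' G) := by
  have hne : ∀ ξ ∈ closure G, ξ ≠ 0 := fun ξ hξ hξ0 => h0 (hξ0 ▸ hξ)
  refine isOpen_image_of_frontier_notMem (S := escapingSet f) hG hGp hGc
    (continuousOn_iterate_closure hfd hf0 h0 n)
    ((hfd.iterate hf0 n).mono fun _ hz => hne _ (subset_closure hz)) (fun ξ hξ => ?_) hz₀ ?_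
  · rw [iterate_mem_escapingSet_iff hf0 n (hne ξ hξ.1)]
    exact hfr ξ hξ
  · rwa [iterate_mem_escapingSet_iff hf0 n (hne z₀ (subset_closure hz₀))]

theorem im_iterate_mul_im_pos (hfd : DifferentiableOn ℂ f {0}ᶜ)
    (hf0 : Set.MapsTo f {0}ᶜ {0}ᶜ) (hreal : ∀ x : ℝ, x ≠ 0 → (x : ℂ) ∈ escapingSet f)
    (hG : IsOpen G) (hGp : IsPreconnected G)
    (hGc : IsCompact (closure G)) (h0 : (0 : ℂ) ∉ closure G)
    (hfr : ∀ ξ ∈ frontier G, ξ ∉ escapingSet f) {z₀ : ℂ} (hz₀ : z₀ ∈ G)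
    (hz₀I : z₀ ∈ escapingSet f) (n : ℕ) :
    ∀ ξ ∈ closure G, ∀ ζ ∈ closure G, 0 < (f^[n] ξ).im * (f^[n] ζ).im := by
  have hne : ∀ ξ ∈ closure G, ξ ≠ 0 := fun ξ hξ hξ0 => h0 (hξ0 ▸ hξ)
  have hc := continuousOn_iterate_closure hfd hf0 h0 n
  have him : ∀ ξ ∈ closure G, (f^[n] ξ).im ≠ 0 := by
    refine im_ne_zero_of_frontier hGc hc
      (fun ξ hξ => mapsTo_iterate_compl_zero hf0 n (hne ξ hξ))
      (isOpen_iterate_image hfd hf0 hG hGp hGc h0 hfr hz₀ hz₀I n) hG fun ξ hξ hξ0 => ?_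
    refine hfr ξ hξ ((iterate_mem_escapingSet_iff hf0 n (hne ξ hξ.1)).1 ?_)
    have hre : f^[n] ξ = ((f^[n] ξ).re : ℂ) := Complex.ext rfl hξ0
    rw [hre]
    refine hreal _ fun hr => mapsTo_iterate_compl_zero hf0 n (hne ξ hξ.1) ?_
    rw [hre, hr, Complex.ofReal_zero]
  intro ξ hξ ζ hζ
  exact (hGp.closure.image _ hc).im_mul_im_pos (Set.forall_mem_image.2 him) _
    (Set.mem_image_of_mem _ hξ) _ (Set.mem_image_of_mem _ hζ)

theorem subset_escapingSet (hfd : DifferentiableOn ℂ f {0}ᶜ)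
    (hf0 : Set.MapsTo f {0}ᶜ {0}ᶜ) (hG : IsOpen G) (hGp : IsPreconnected G)
    (h0 : (0 : ℂ) ∉ G)
    (him : ∀ n, ∀ ξ ∈ G, ∀ ζ ∈ G, 0 < (f^[n] ξ).im * (f^[n] ζ).im)
    {z₀ : ℂ} (hz₀ : z₀ ∈ G) (hz₀I : z₀ ∈ escapingSet f) : G ⊆ escapingSet f := by
  have hne : ∀ ξ ∈ G, ξ ≠ 0 := fun ξ hξ hξ0 => h0 (hξ0 ▸ hξ)
  have hlocal : ∀ c ∈ G, ∃ r > 0, Metric.ball c r ⊆ G ∧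
      ∀ z ∈ Metric.ball c r, z ∈ escapingSet f ↔ c ∈ escapingSet f := by
    intro c hc
    obtain ⟨r, hr, hball⟩ := Metric.isOpen_iff.1 hG c hc
    have hsub : Metric.ball c (r / 2) ⊆ G :=
      (Metric.ball_subset_ball (by linarith)).trans hball
    have hH : ∀ z ∈ Metric.ball c (r / 2), ∀ n,
        ‖f^[n] z‖ ≤ 3 * ‖f^[n] c‖ ∧ ‖f^[n] c‖ ≤ 3 * ‖f^[n] z‖ := fun z hz n =>
      norm_le_three_mul_norm hr ((hfd.iterate hf0 n).mono fun w hw => hne w (hball hw))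
        (fun w hw => him n c hc w (hball hw)) hz
    exact ⟨r / 2, half_pos hr, hsub, fun z hz =>
      ⟨mem_escapingSet_of_norm_le (hne c hc) fun n => (hH z hz n).symm,
        mem_escapingSet_of_norm_le (hne z (hsub hz)) (hH z hz)⟩⟩
  have ho₁ : IsOpen (G ∩ escapingSet f) := Metric.isOpen_iff.2 fun c hc => by
    obtain ⟨r, hr, hball, h⟩ := hlocal c hc.1
    exact ⟨r, hr, fun z hz => ⟨hball hz, (h z hz).2 hc.2⟩⟩
  have ho₂ : IsOpen (G \ escapingSet f) := Metric.isOpen_iff.2 fun c hc => by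
    obtain ⟨r, hr, hball, h⟩ := hlocal c hc.1
    exact ⟨r, hr, fun z hz => ⟨hball hz, fun hz' => hc.2 ((h z hz).1 hz')⟩⟩
  refine (hGp.subset_left_of_subset_union ho₁ ho₂
    (Set.disjoint_sdiff_right.mono_left Set.inter_subset_right) (Set.inter_union_sdiff _ _).ge
    ⟨z₀, hz₀, hz₀, hz₀I⟩).trans Set.inter_subset_right

theorem pairwise_disjoint_iterate_image (hfd : DifferentiableOn ℂ f {0}ᶜ)
    (hf0 : Set.MapsTo f {0}ᶜ {0}ᶜ) (hGp : IsPreconnected G)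
    (hGc : IsCompact (closure G)) (h0 : (0 : ℂ) ∉ closure G)
    (hfr : ∀ ξ ∈ frontier G, ξ ∉ escapingSet f) (hopen : ∀ n, IsOpen (f^[n] '' G))
    (hGI : G ⊆ escapingSet f) : Pairwise (Function.onFun Disjoint fun n => f^[n] '' G) := by
  have hne : ∀ ξ ∈ closure G, ξ ≠ 0 := fun ξ hξ hξ0 => h0 (hξ0 ▸ hξ)
  refine (pairwise_disjoint_on _).2 fun m n hmn => Set.disjoint_left.2 ?_
  rintro w hwm hwn
  have hK : IsCompact (f^[m] '' closure G) :=
    hGc.image_of_continuousOn (continuousOn_iterate_closure hfd hf0 h0 m)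
  have hKG : f^[n] '' G ⊆ f^[m] '' G ∪ (f^[m] '' closure G)ᶜ := by
    rintro _ ⟨z, hz, rfl⟩
    by_contra hcon
    rw [Set.mem_union, not_or, Set.notMem_compl_iff] at hcon
    obtain ⟨hcon, ξ, hξ, hξz⟩ := hcon
    refine hfr ξ ⟨hξ, fun hξG => hcon ⟨ξ, interior_subset hξG, hξz⟩⟩ ?_
    rw [← iterate_mem_escapingSet_iff hf0 m (hne ξ hξ), hξz,
      iterate_mem_escapingSet_iff hf0 n (hne z (subset_closure hz))]
    exact hGI hz
  have hsub : f^[n] '' G ⊆ f^[m] '' G :=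
    (hGp.image _ ((continuousOn_iterate_closure hfd hf0 h0 n).mono
      subset_closure)).subset_left_of_subset_union (hopen m) hK.isClosed.isOpen_compl
        (Set.disjoint_compl_right_iff_subset.2 (Set.image_mono subset_closure)) hKG ⟨w, hwn, hwm⟩
  obtain ⟨z, hz, -⟩ := hwm
  have hmaps : Set.MapsTo f^[n - m] (f^[m] '' G) (f^[m] '' G) := by
    rintro _ ⟨y, hy, rfl⟩
    rw [← Function.iterate_add_apply, Nat.sub_add_cancel hmn.le]
    exact hsub (Set.mem_image_of_mem _ hy)
  have hzI : f^[m] z ∈ escapingSet f :=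
    (iterate_mem_escapingSet_iff hf0 m (hne z (subset_closure hz))).2 (hGI hz)
  obtain ⟨N, hN⟩ := exists_iterate_notMem_of_isCompact hzI hK (by
    rintro ⟨y, hy, hy0⟩
    exact mapsTo_iterate_compl_zero hf0 m (hne y hy) hy0)
  refine hN ((n - m) * N) (Nat.le_mul_of_pos_left N (by omega)) ?_
  rw [Function.iterate_mul]
  exact Set.image_mono subset_closure (hmaps.iterate N (Set.mem_image_of_mem _ hz))

/-- A bounded domain in the punctured plane that contains an escaping point has an escaping
point on its boundary, provided that the nonzero reals escape. -/
theorem exists_mem_frontier_escapingSet (hfd : DifferentiableOn ℂ f {0}ᶜ)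
    (hf0 : Set.MapsTo f {0}ᶜ {0}ᶜ) (hreal : ∀ x : ℝ, x ≠ 0 → (x : ℂ) ∈ escapingSet f)
    (hG : IsOpen G) (hGp : IsPreconnected G) (hGc : IsCompact (closure G))
    (h0 : (0 : ℂ) ∉ closure G) {z₀ : ℂ} (hz₀ : z₀ ∈ G) (hz₀I : z₀ ∈ escapingSet f) :
    ∃ ξ ∈ frontier G, ξ ∈ escapingSet f := by
  by_contra! hfr
  have hne : ∀ ξ ∈ closure G, ξ ≠ 0 := fun ξ hξ hξ0 => h0 (hξ0 ▸ hξ)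
  have hopen := isOpen_iterate_image hfd hf0 hG hGp hGc h0 hfr hz₀ hz₀I
  have him := im_iterate_mul_im_pos hfd hf0 hreal hG hGp hGc h0 hfr hz₀ hz₀I
  have hGI := subset_escapingSet hfd hf0 hG hGp (fun h => h0 (subset_closure h))
    (fun n ξ hξ ζ hζ => him n ξ (subset_closure hξ) ζ (subset_closure hζ)) hz₀ hz₀I
  have hdisj := pairwise_disjoint_iterate_image hfd hf0 hGp hGc h0 hfr hopen hGI
  set T : ℝ → ℕ → ℝ := fun R n =>
    Real.log 3 * (Real.circleAverage ((f^[n] '' G).indicator 1) 0 (Real.exp 1 * R) +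
      Real.circleAverage ((f^[n] '' G).indicator 1) 0 (Real.exp 1 * R)⁻¹) with hT
  have hTs : ∀ R, Summable (T R) := fun R =>
    ((summable_circleAverage_indicator hopen hdisj _).add
      (summable_circleAverage_indicator hopen hdisj _)).mul_left _
  have hbar : ∀ j : ℕ, ∃ N : ℕ, (∀ M, ∑ n ∈ Finset.Ico N M, T (j + 1) n ≤ (1 / 2) ^ j / 4) ∧
      ∀ n ≥ N, ∃ h : ℂ → ℝ, LowerSemicontinuousOn h (closure G) ∧ HasMeanValueOn h G ∧
        (∀ ξ ∈ closure G, 0 ≤ h ξ) ∧ h z₀ ≤ T (j + 1) n ∧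
        ∀ ξ ∈ closure G, h ξ < 1 → (j + 1 : ℝ) < ‖f^[n] ξ‖ ∨ ‖f^[n] ξ‖ < (j + 1 : ℝ)⁻¹ := by
    intro j
    have hj : (0 : ℝ) < j + 1 := by positivity
    have heR : 0 < Real.exp 1 * (j + 1 : ℝ) := by positivity
    obtain ⟨s, hs⟩ := (hTs (j + 1)).vanishing
      (Metric.ball_mem_nhds (0 : ℝ) (show (0 : ℝ) < (1 / 2) ^ j / 4 by positivity))
    obtain ⟨N, hN⟩ := hz₀I.2 (1 / (2 * (Real.exp 1 * (j + 1)))) (by positivity)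
    refine ⟨max N (s.sup id + 1), fun M => ?_, fun n hn => ?_⟩
    · have hmem := hs (Finset.Ico (max N (s.sup id + 1)) M)
        (Finset.disjoint_left.2 fun n hn hns => by
          have h₁ := Finset.le_sup (f := id) hns
          have h₂ := (le_max_right _ _).trans (Finset.mem_Ico.1 hn).1
          simp only [id_eq] at h₁
          omega)
      rw [mem_ball_zero_iff] at hmem
      exact (le_abs_self _).trans hmem.le
    · refine exists_barrier hG (continuousOn_iterate_closure hfd hf0 h0 n)
        ((hfd.iterate hf0 n).mono fun _ hz => hne _ (subset_closure hz))
        (fun ξ hξ => mapsTo_iterate_compl_zero hf0 n (hne ξ hξ)) (hopen n)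
        (fun ξ hξ => Set.forall_mem_image.2 fun ζ hζ => him n ξ hξ ζ (subset_closure hζ)) hz₀ hj ?_
      rcases hN n ((le_max_left _ _).trans hn) with h | h
      · right
        rw [← div_div, lt_div_iff₀ heR] at h
        rw [← one_div, le_div_iff₀ heR]
        linarith
      · left
        rw [one_div_one_div] at h
        exact h.le
  choose N hNs hNh using hbar
  choose! h hls hmv hnn hz₀h hlt using hNh
  have hM : ∀ M : ℕ, ∃ ξ ∈ frontier G, ∀ j < M, ∀ n, N j ≤ n → n < M →
      (j + 1 : ℝ) < ‖f^[n] ξ‖ ∨ ‖f^[n] ξ‖ < (j + 1 : ℝ)⁻¹ := by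
    intro M
    set S : ℂ → ℝ := fun z => ∑ j ∈ Finset.range M, ∑ n ∈ Finset.Ico (N j) M, h j n z with hS
    have hSls : LowerSemicontinuousOn S (closure G) :=
      lowerSemicontinuousOn_sum fun j _ => lowerSemicontinuousOn_sum fun n hn =>
        hls j n (Finset.mem_Ico.1 hn).1
    have hSmv : HasMeanValueOn S G := hasMeanValueOn_sum _ fun j _ => hasMeanValueOn_sum _
      fun n hn => hmv j n (Finset.mem_Ico.1 hn).1
    have hS₀ : S z₀ < 1 := by
      have h₁ : S z₀ ≤ ∑ j ∈ Finset.range M, (1 / 2 : ℝ) ^ j / 4 :=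
        Finset.sum_le_sum fun j _ => (Finset.sum_le_sum fun n hn =>
          hz₀h j n (Finset.mem_Ico.1 hn).1).trans (hNs j M)
      have h₂ := sum_geometric_two_le M
      rw [← Finset.sum_div] at h₁
      linarith
    obtain ⟨ξ, hξ, hle⟩ := hSmv.exists_frontier_le hG hGc hSls hz₀
    refine ⟨ξ, hξ, fun j hj n hn hnM => hlt j n hn ξ hξ.1 ?_⟩
    refine lt_of_le_of_lt ?_ (hle.trans_lt hS₀)
    have h₁ : h j n ξ ≤ ∑ n ∈ Finset.Ico (N j) M, h j n ξ :=
      Finset.single_le_sum (f := fun n => h j n ξ)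
        (fun k hk => hnn j k (Finset.mem_Ico.1 hk).1 ξ hξ.1) (Finset.mem_Ico.2 ⟨hn, hnM⟩)
    refine h₁.trans (Finset.single_le_sum (f := fun j => ∑ n ∈ Finset.Ico (N j) M, h j n ξ)
      (fun i _ => Finset.sum_nonneg fun k hk => hnn i k (Finset.mem_Ico.1 hk).1 ξ hξ.1)
      (Finset.mem_range.2 hj))
  choose ξ hξfr hξ using hM
  obtain ⟨ζ, hζ, φ, hφ, hlim⟩ :=
    (hGc.of_isClosed_subset isClosed_frontier frontier_subset_closure).tendsto_subseq hξfr
  refine hfr ζ hζ ⟨hne ζ hζ.1, fun ε hε => ?_⟩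
  obtain ⟨j, hj⟩ := exists_nat_gt (1 / ε)
  refine ⟨N j, fun n hn => ?_⟩
  have hcont : ContinuousAt f^[n] ζ :=
    ((hfd.iterate hf0 n).differentiableAt
      (isOpen_compl_singleton.mem_nhds (hne ζ hζ.1))).continuousAt
  have hcl : IsClosed {w : ℂ | (j + 1 : ℝ) ≤ ‖w‖ ∨ ‖w‖ ≤ (j + 1 : ℝ)⁻¹} :=
    (isClosed_le continuous_const continuous_norm).union
      (isClosed_le continuous_norm continuous_const)
  have hmem : f^[n] ζ ∈ {w : ℂ | (j + 1 : ℝ) ≤ ‖w‖ ∨ ‖w‖ ≤ (j + 1 : ℝ)⁻¹} := by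
    refine hcl.mem_of_tendsto (hcont.tendsto.comp hlim) ?_
    filter_upwards [eventually_gt_atTop j, eventually_gt_atTop n] with k hkj hkn
    exact (hξ (φ k) j (hkj.trans_le (hφ.id_le k)) n hn (hkn.trans_le (hφ.id_le k))).imp
      le_of_lt le_of_lt
  rcases hmem with h' | h'
  · right
    linarith
  · left
    refine h'.trans_lt ?_
    rw [inv_lt_comm₀ (by positivity) hε, ← one_div]
    linarith

end

theorem infty_mem_closure_range_ofReal :
    (∞ : OnePoint ℂ) ∈ closure (Set.range fun x : ℝ => ((x : ℂ) : OnePoint ℂ)) := by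
  have h : Tendsto (fun n : ℕ => (((n : ℝ) : ℂ) : OnePoint ℂ)) atTop (𝓝 ∞) := by
    refine OnePoint.tendsto_coe_infty.comp ?_
    rw [coclosedCompact_eq_cocompact, ← Metric.cobounded_eq_cocompact,
      ← tendsto_norm_atTop_iff_cobounded]
    simpa using tendsto_natCast_atTop_atTop (R := ℝ)
  exact mem_closure_of_tendsto h (Eventually.of_forall fun n => ⟨n, rfl⟩)

/-- If a holomorphic self-map of the punctured plane has all nonzero reals in its escaping set,
then `I(f) ∪ {0, ∞}` is preconnected. -/
theorem isPreconnected_escapingSphere {f : ℂ → ℂ} (hfd : DifferentiableOn ℂ f {0}ᶜ)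
    (hf0 : Set.MapsTo f {0}ᶜ {0}ᶜ) (hreal : ∀ x : ℝ, x ≠ 0 → (x : ℂ) ∈ escapingSet f) :
    IsPreconnected (escapingSphere f) := by
  have hinfty : ∞ ∈ escapingSphere f := Or.inr (Or.inr rfl)
  have hcoe : ∀ z : ℂ, (z : OnePoint ℂ) ∈ escapingSphere f ↔ z = 0 ∨ z ∈ escapingSet f := by
    intro z
    simp [escapingSphere, or_comm]
  suffices key : ∀ u v : Set (OnePoint ℂ), IsOpen u → IsOpen v → escapingSphere f ⊆ u ∪ v →
      escapingSphere f ∩ (u ∩ v) = ∅ → ∞ ∈ u → escapingSphere f ⊆ u by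
    refine isPreconnected_iff_subset_of_disjoint.2 fun u v hu hv huv hd => ?_
    rcases huv hinfty with h | h
    · exact Or.inl (key u v hu hv huv hd h)
    · exact Or.inr (key v u hv hu (Set.union_comm u v ▸ huv) (Set.inter_comm u v ▸ hd) h)
  intro u v hu hv huv hd hiu
  have hd' : ∀ p ∈ escapingSphere f, p ∈ u → p ∉ v := fun p hp hpu hpv =>
    Set.eq_empty_iff_forall_notMem.1 hd p ⟨hp, hpu, hpv⟩
  set L : Set (OnePoint ℂ) := Set.range fun x : ℝ => ((x : ℂ) : OnePoint ℂ) with hL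
  have hLp : IsPreconnected (insert ∞ L) :=
    (isPreconnected_range (OnePoint.continuous_coe.comp Complex.continuous_ofReal)).subset_closure
      (Set.subset_insert _ _)
      (Set.insert_subset infty_mem_closure_range_ofReal subset_closure)
  have hLK : insert ∞ L ⊆ escapingSphere f := by
    rintro _ (rfl | ⟨x, rfl⟩)
    · exact hinfty
    · rcases eq_or_ne x 0 with rfl | hx
      · exact (hcoe _).2 (Or.inl Complex.ofReal_zero)
      · exact (hcoe _).2 (Or.inr (hreal x hx))
  have hLu : insert ∞ L ⊆ u := by
    refine (isPreconnected_iff_subset_of_disjoint.1 hLp u v hu hv (hLK.trans huv)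
      (Set.subset_eq_empty (Set.inter_subset_inter_left _ hLK) hd)).resolve_right fun h => ?_
    exact hd' _ hinfty hiu (h (Set.mem_insert _ _))
  have h0u : ((0 : ℂ) : OnePoint ℂ) ∈ u := hLu (Or.inr ⟨0, by simp⟩)
  by_contra hcon
  obtain ⟨p, hpK, hpu⟩ := Set.not_subset.1 hcon
  induction p using OnePoint.rec with
  | infty => exact hpu hiu
  | coe z₀ =>
  have hz₀I : z₀ ∈ escapingSet f := by
    refine ((hcoe z₀).1 hpK).resolve_left ?_
    rintro rfl
    exact hpu h0u
  have hz₀v := (huv hpK).resolve_left hpu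
  set u' : Set ℂ := (↑) ⁻¹' u with hu'
  set v' : Set ℂ := (↑) ⁻¹' v with hv'
  have hu'o : IsOpen u' := hu.preimage OnePoint.continuous_coe
  have hv'o : IsOpen v' := hv.preimage OnePoint.continuous_coe
  set J : Set ℂ := insert 0 (escapingSet f) with hJ
  have hJuv : ∀ z ∈ J, z ∈ u' → z ∉ v' := fun z hz => hd' z ((hcoe z).2 hz)
  obtain ⟨R, hR⟩ : ∃ R : ℝ, ∀ z : ℂ, R ≤ ‖z‖ → z ∈ u' := by
    have h := OnePoint.tendsto_coe_infty (X := ℂ) (hu.mem_nhds hiu)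
    rw [coclosedCompact_eq_cocompact, ← Metric.cobounded_eq_cocompact] at h
    obtain ⟨R, -, hR⟩ := hasBasis_cobounded_norm.mem_iff.1 (mem_map.1 h)
    exact ⟨R, fun z hz => hR hz⟩
  have hA : Disjoint (closure (J ∩ u')) (J ∩ v') :=
    Set.disjoint_left.2 fun z hz hz' => by
      obtain ⟨y, hyv, hyJ, hyu⟩ := mem_closure_iff.1 hz v' hv'o hz'.2
      exact hJuv y hyJ hyu hyv
  have hB : Disjoint (J ∩ u') (closure (J ∩ v')) :=
    Set.disjoint_right.2 fun z hz hz' => by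
      obtain ⟨y, hyu, hyJ, hyv⟩ := mem_closure_iff.1 hz u' hu'o hz'.2
      exact hJuv y hyJ hyu hyv
  obtain ⟨U, V, hU, hV, hAU, hBV, hUV⟩ :=
    separatedNhds_iff_disjoint.2 (completely_normal hA hB)
  set W := V ∩ Metric.ball 0 R with hW
  have hBW : J ∩ v' ⊆ W := fun z hz => by
    refine ⟨hBV hz, mem_ball_zero_iff.2 ?_⟩
    by_contra! hle
    exact hJuv z hz.1 (hR z hle) hz.2
  have hz₀W : z₀ ∈ W := hBW ⟨Or.inr hz₀I, hz₀v⟩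
  set G := connectedComponentIn W z₀ with hGdef
  have hGW : G ⊆ W := connectedComponentIn_subset W z₀
  have hG : IsOpen G := (hV.inter Metric.isOpen_ball).connectedComponentIn
  have hGU : ∀ z ∈ U, z ∉ closure G := fun z hz hzG => by
    obtain ⟨y, hyU, hyG⟩ := mem_closure_iff.1 hzG U hU hz
    exact Set.disjoint_left.1 hUV hyU (hGW hyG).1
  have hGp : IsPreconnected G := isPreconnected_connectedComponentIn
  obtain ⟨ξ, hξ, hξI⟩ := exists_mem_frontier_escapingSet hfd hf0 hreal hG hGp
    (Metric.isBounded_ball.subset (hGW.trans Set.inter_subset_right)).isCompact_closure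
    (hGU 0 (hAU ⟨Or.inl rfl, h0u⟩)) (mem_connectedComponentIn hz₀W) hz₀I
  rcases huv ((hcoe ξ).2 (Or.inr hξI)) with h | h
  · exact hGU ξ (hAU ⟨Or.inr hξI, h⟩) hξ.1
  · have hins : insert ξ G ⊆ G :=
      (hGp.subset_closure (Set.subset_insert _ _)
        (Set.insert_subset hξ.1 subset_closure)).subset_connectedComponentIn
          (Or.inr (mem_connectedComponentIn hz₀W))
          (Set.insert_subset (hBW ⟨Or.inr hξI, h⟩) hGW)
    exact hξ.2 (hG.interior_eq.symm ▸ hins (Set.mem_insert _ _))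

theorem isTranscendentalSelfMapCStar_example {f : ℂ → ℂ}
    (hf : ∀ z : ℂ, f z = 2 * z * Complex.exp (z ^ 2 + Complex.exp (-(z ^ 4)⁻¹))) :
    IsTranscendentalSelfMapCStar f := by
  refine ⟨1, fun z => z ^ 2 + Complex.log 2, fun w => Complex.exp (-w ^ 4), by fun_prop,
    by fun_prop, ?_, ?_, fun z _ => ?_⟩
  · rintro ⟨c, hc⟩
    have h := (hc 1).trans (hc 0).symm
    norm_num at h
  · rintro ⟨c, hc⟩
    have h := congrArg norm ((hc 1).trans (hc 0).symm)
    norm_num [Complex.norm_exp] at h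
  · have h2 : Complex.exp (z ^ 2 + Complex.log 2 + Complex.exp (-z⁻¹ ^ 4)) =
        2 * Complex.exp (z ^ 2 + Complex.exp (-(z ^ 4)⁻¹)) := by
      rw [add_right_comm, Complex.exp_add _ (Complex.log 2), Complex.exp_log two_ne_zero, inv_pow,
        mul_comm]
    rw [hf, zpow_one, h2]
    ring

theorem exists_iterate_ofReal {f : ℂ → ℂ}
    (hf : ∀ z : ℂ, f z = 2 * z * Complex.exp (z ^ 2 + Complex.exp (-(z ^ 4)⁻¹))) (n : ℕ) (x : ℝ) :
    ∃ y : ℝ, f^[n] x = y ∧ 2 ^ n * |x| ≤ |y| := by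
  induction n with
  | zero => exact ⟨x, rfl, by simp⟩
  | succ n ih =>
    obtain ⟨y, hy, hle⟩ := ih
    refine ⟨2 * y * Real.exp (y ^ 2 + Real.exp (-(y ^ 4)⁻¹)), ?_, ?_⟩
    · rw [Function.iterate_succ_apply', hy, hf]
      push_cast
      rfl
    · have h₁ : 1 ≤ Real.exp (y ^ 2 + Real.exp (-(y ^ 4)⁻¹)) := Real.one_le_exp (by positivity)
      rw [abs_mul, abs_mul, abs_two, Real.abs_exp, pow_succ]
      nlinarith [abs_nonneg y]

theorem iterate_ofReal_ne_zero {f : ℂ → ℂ}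
    (hf : ∀ z : ℂ, f z = 2 * z * Complex.exp (z ^ 2 + Complex.exp (-(z ^ 4)⁻¹)))
    {x : ℝ} (hx : x ≠ 0) (n : ℕ) : f^[n] x ≠ 0 := by
  obtain ⟨y, hy, hle⟩ := exists_iterate_ofReal hf n x
  have hpos : 0 < |y| := lt_of_lt_of_le (by positivity) hle
  rw [hy, Complex.ofReal_ne_zero]
  exact abs_pos.1 hpos

theorem tendsto_norm_iterate_ofReal {f : ℂ → ℂ}
    (hf : ∀ z : ℂ, f z = 2 * z * Complex.exp (z ^ 2 + Complex.exp (-(z ^ 4)⁻¹)))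
    {x : ℝ} (hx : x ≠ 0) :
    Tendsto (fun n : ℕ => ‖f^[n] (x : ℂ)‖) atTop atTop := by
  refine tendsto_atTop_mono (f := fun n : ℕ => 2 ^ n * |x|) (fun n => ?_)
    ((tendsto_pow_atTop_atTop_of_one_lt one_lt_two).atTop_mul_const (abs_pos.2 hx))
  obtain ⟨y, hy, hle⟩ := exists_iterate_ofReal hf n x
  rwa [hy, Complex.norm_real]

theorem ofReal_mem_escapingSet {f : ℂ → ℂ}
    (hf : ∀ z : ℂ, f z = 2 * z * Complex.exp (z ^ 2 + Complex.exp (-(z ^ 4)⁻¹)))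
    {x : ℝ} (hx : x ≠ 0) : (x : ℂ) ∈ escapingSet f := by
  refine ⟨Complex.ofReal_ne_zero.2 hx, fun ε _ => ?_⟩
  obtain ⟨N, hN⟩ := eventually_atTop.1
    ((tendsto_norm_iterate_ofReal hf hx).eventually_gt_atTop (1 / ε))
  exact ⟨N, fun n hn => Or.inr (hN n hn)⟩

theorem exists_apply_ofReal_mul_I {f : ℂ → ℂ}
    (hf : ∀ z : ℂ, f z = 2 * z * Complex.exp (z ^ 2 + Complex.exp (-(z ^ 4)⁻¹))) (y : ℝ) :
    ∃ t : ℝ, f (y * Complex.I) = t * Complex.I ∧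
      (y ≠ 0 → t ≠ 0) ∧ |t| ≤ 6 ∧ (|y| < 1 / 6 → 3 / 2 * |y| ≤ |t|) := by
  have habs : |2 * y * Real.exp (-y ^ 2 + Real.exp (-(y ^ 4)⁻¹))| =
      2 * |y| * (Real.exp (-y ^ 2) * Real.exp (Real.exp (-(y ^ 4)⁻¹))) := by
    rw [abs_mul, abs_mul, abs_two, Real.abs_exp, Real.exp_add]
  have h₁ : 1 ≤ Real.exp (Real.exp (-(y ^ 4)⁻¹)) := Real.one_le_exp (by positivity)
  refine ⟨2 * y * Real.exp (-y ^ 2 + Real.exp (-(y ^ 4)⁻¹)), ?_, fun hy => by positivity, ?_,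
    fun hy => ?_⟩
  · rw [hf, mul_pow, mul_pow, Complex.I_sq, Complex.I_pow_four]
    push_cast
    ring_nf
  · have h₂ : Real.exp (Real.exp (-(y ^ 4)⁻¹)) ≤ 3 := by
      have h₃ : Real.exp (-(y ^ 4)⁻¹) ≤ 1 := Real.exp_le_one_iff.2 (by simp; positivity)
      exact (Real.exp_le_exp.2 h₃).trans Real.exp_one_lt_three.le
    have h₄ : |y| * Real.exp (-y ^ 2) ≤ 1 := by
      rw [Real.exp_neg, ← div_eq_mul_inv, div_le_one (Real.exp_pos _)]
      have := Real.add_one_le_exp (y ^ 2)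
      rw [← sq_abs] at this ⊢
      nlinarith [sq_nonneg (|y| - 1)]
    have h₅ : 0 ≤ |y| * Real.exp (-y ^ 2) := by positivity
    rw [habs]
    nlinarith
  · have h₂ := Real.add_one_le_exp (-y ^ 2)
    have h₃ : y ^ 2 ≤ 1 / 4 := by
      rw [← sq_abs]
      nlinarith [abs_nonneg y]
    have h₄ : 3 / 4 ≤ Real.exp (-y ^ 2) * Real.exp (Real.exp (-(y ^ 4)⁻¹)) := by nlinarith
    rw [habs]
    nlinarith [abs_nonneg y]

theorem ofReal_mul_I_notMem_escapingSet {f : ℂ → ℂ}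
    (hf : ∀ z : ℂ, f z = 2 * z * Complex.exp (z ^ 2 + Complex.exp (-(z ^ 4)⁻¹)))
    {y : ℝ} (hy : y ≠ 0) :
    (y : ℂ) * Complex.I ∉ escapingSet f := by
  rintro ⟨-, h⟩
  choose t ht ht0 ht6 htexp using exists_apply_ofReal_mul_I hf
  have hiter : ∀ n, f^[n] (y * Complex.I) = (t^[n] y : ℝ) * Complex.I := fun n => by
    induction n with
    | zero => rfl
    | succ n ih => rw [Function.iterate_succ_apply', Function.iterate_succ_apply', ih, ht]
  have hne : ∀ n, t^[n] y ≠ 0 := fun n => by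
    induction n with
    | zero => exact hy
    | succ n ih =>
      rw [Function.iterate_succ_apply']
      exact ht0 _ ih
  obtain ⟨N, hN⟩ := h (1 / 6) (by norm_num)
  have hsmall : ∀ k, |t^[N + 1 + k] y| < 1 / 6 := fun k => by
    have h₁ := hN (N + 1 + k) (by omega)
    rw [hiter, norm_mul, Complex.norm_I, mul_one, Complex.norm_real, Real.norm_eq_abs] at h₁
    refine h₁.resolve_right fun h₂ => ?_
    rw [show N + 1 + k = N + k + 1 by omega, Function.iterate_succ_apply'] at h₂
    linarith [ht6 (t^[N + k] y)]
  have hgrow : ∀ k, (3 / 2) ^ k * |t^[N + 1] y| ≤ |t^[N + 1 + k] y| := fun k => by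
    induction k with
    | zero => simp
    | succ k ih =>
      rw [← add_assoc, Function.iterate_succ_apply' t (N + 1 + k), pow_succ]
      linarith [htexp _ (hsmall k)]
  obtain ⟨k, hk⟩ := pow_unbounded_of_one_lt (1 / |t^[N + 1] y|) (show (1 : ℝ) < 3 / 2 by norm_num)
  rw [div_lt_iff₀ (abs_pos.2 (hne _))] at hk
  linarith [hgrow k, hsmall k]

theorem not_isPreconnected_escapingSet_example {f : ℂ → ℂ}
    (hf : ∀ z : ℂ, f z = 2 * z * Complex.exp (z ^ 2 + Complex.exp (-(z ^ 4)⁻¹))) :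
    ¬ IsPreconnected (escapingSet f) := by
  intro h
  have hcover : escapingSet f ⊆ {z | z.re < 0} ∪ {z | 0 < z.re} := fun z hz => by
    refine lt_or_gt_of_ne (a := z.re) (b := 0) fun hre => ?_
    have hz' : z = z.im * Complex.I := by
      apply Complex.ext <;> simp [hre]
    refine ofReal_mul_I_notMem_escapingSet hf (y := z.im) (fun him => hz.1 ?_) (hz' ▸ hz)
    exact Complex.ext hre him
  obtain ⟨z, -, hz₁, hz₂⟩ := h {z | z.re < 0} {z | 0 < z.re}
    (isOpen_lt Complex.continuous_re continuous_const)
    (isOpen_lt continuous_const Complex.continuous_re) hcover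
    ⟨(-1 : ℝ), ofReal_mem_escapingSet hf (by norm_num), by simp⟩
    ⟨(1 : ℝ), ofReal_mem_escapingSet hf one_ne_zero, by simp⟩
  exact lt_asymm (show z.re < 0 from hz₁) hz₂

theorem isConnected_escapingSphere_example {f : ℂ → ℂ}
    (hf : ∀ z : ℂ, f z = 2 * z * Complex.exp (z ^ 2 + Complex.exp (-(z ^ 4)⁻¹))) :
    IsConnected (escapingSphere f) := by
  refine ⟨⟨∞, Or.inr (Or.inr rfl)⟩, isPreconnected_escapingSphere ?_ (fun z hz => ?_)
    fun x hx => ofReal_mem_escapingSet hf hx⟩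
  · rw [funext hf]
    refine fun z hz => DifferentiableAt.differentiableWithinAt ?_
    have hz4 : z ^ 4 ≠ 0 := pow_ne_zero 4 hz
    fun_prop (disch := assumption)
  · rw [Set.mem_compl_singleton_iff] at hz ⊢
    rw [hf]
    exact mul_ne_zero (mul_ne_zero two_ne_zero hz) (Complex.exp_ne_zero _)

/-- For `f(z) = 2z·exp(z² + exp(−1/z⁴))`: `f` is a transcendental self-map
of `ℂ*`; real orbits stay real, nonzero, and escape to `∞`, so `ℝ \ {0} ⊆ I(f)`; purely
imaginary points are not in `I(f)`. Consequently `I(f)` is disconnected while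
`I(f) ∪ {0,∞} ⊆ ℂ̂` is connected. -/
theorem example_type_I2 (f : ℂ → ℂ)
    (hf : ∀ z : ℂ, f z = 2 * z * Complex.exp (z ^ 2 + Complex.exp (-(z ^ 4)⁻¹))) :
    IsTranscendentalSelfMapCStar f ∧
    (∀ x : ℝ, x ≠ 0 →
      (∀ n : ℕ, (f^[n] (x : ℂ)).im = 0 ∧ f^[n] (x : ℂ) ≠ 0) ∧
      Tendsto (fun n : ℕ => ‖f^[n] (x : ℂ)‖) atTop atTop) ∧
    {z : ℂ | z.im = 0 ∧ z ≠ 0} ⊆ escapingSet f ∧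
    (∀ y : ℝ, y ≠ 0 → (y : ℂ) * Complex.I ∉ escapingSet f) ∧
    ¬ IsPreconnected (escapingSet f) ∧
    IsConnected (escapingSphere f) := by
  refine ⟨isTranscendentalSelfMapCStar_example hf, fun x hx => ⟨fun n => ⟨?_,
    iterate_ofReal_ne_zero hf hx n⟩, tendsto_norm_iterate_ofReal hf hx⟩, fun z hz => ?_,
    fun y hy => ofReal_mul_I_notMem_escapingSet hf hy, not_isPreconnected_escapingSet_example hf,
    isConnected_escapingSphere_example hf⟩
  · obtain ⟨y, hy, -⟩ := exists_iterate_ofReal hf n x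
    rw [hy, Complex.ofReal_im]
  · have hre : z = (z.re : ℂ) := Complex.ext rfl hz.1
    rw [hre]
    exact ofReal_mem_escapingSet hf fun h => hz.2 (by rw [hre, h, Complex.ofReal_zero])
end
end

section
/- Let f(z) = exp((z + 1/z)/2) for z ∈ ℂ* = ℂ \ {0}. Then f is a transcendental self-map of ℂ*, the set I_∞(f) = {z ∈ ℂ* : |fⁿ(z)| → ∞ as n → ∞} is connected, and the escaping set I(f) is connected. Moreover, the escaping set {z ∈ ℂ : |coshⁿ(z)| → ∞ as n → ∞} of the entire function cosh, which is a lift of f (i.e. exp(cosh z) = f(exp z) for all z ∈ ℂ), is connected. -/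
open Complex Topology Filter Set Function OnePoint

noncomputable section

open scoped ComplexConjugate

/-- The `n`-th preimage of the real line under `cosh`. -/
def coshRealPreimage (n : ℕ) : Set ℂ := {z | (Complex.cosh^[n] z).im = 0}

/-- The closed half-strip `{x + iy : 0 ≤ x, 0 ≤ y ≤ π}`. -/
def closedHalfStrip : Set ℂ := {z | 0 ≤ z.re ∧ 0 ≤ z.im ∧ z.im ≤ Real.pi}

theorem cosh_re_eq (z : ℂ) : (Complex.cosh z).re = Real.cosh z.re * Real.cos z.im := by
  conv_lhs => rw [← Complex.re_add_im z]
  rw [Complex.cosh_add, Complex.cosh_mul_I, Complex.sinh_mul_I, ← Complex.ofReal_cosh,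
    ← Complex.ofReal_sinh, ← Complex.ofReal_cos, ← Complex.ofReal_sin]
  simp [-Complex.ofReal_cos, -Complex.ofReal_sin, -Complex.ofReal_cosh, -Complex.ofReal_sinh]

theorem cosh_im_eq (z : ℂ) : (Complex.cosh z).im = Real.sinh z.re * Real.sin z.im := by
  conv_lhs => rw [← Complex.re_add_im z]
  rw [Complex.cosh_add, Complex.cosh_mul_I, Complex.sinh_mul_I, ← Complex.ofReal_cosh,
    ← Complex.ofReal_sinh, ← Complex.ofReal_cos, ← Complex.ofReal_sin]
  simp [-Complex.ofReal_cos, -Complex.ofReal_sin, -Complex.ofReal_cosh, -Complex.ofReal_sinh]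

theorem norm_sinh_sq (z : ℂ) :
    ‖Complex.sinh z‖ ^ 2 = Real.sinh z.re ^ 2 + Real.sin z.im ^ 2 := by
  conv_lhs => rw [← Complex.re_add_im z]
  rw [Complex.sinh_add, Complex.cosh_mul_I, Complex.sinh_mul_I, ← Complex.ofReal_cosh,
    ← Complex.ofReal_sinh, ← Complex.ofReal_cos, ← Complex.ofReal_sin, ← Complex.normSq_eq_norm_sq,
    Complex.normSq_apply]
  simp [-Complex.ofReal_cos, -Complex.ofReal_sin, -Complex.ofReal_cosh, -Complex.ofReal_sinh]
  nlinarith [Real.cosh_sq z.re, Real.sin_sq_add_cos_sq z.im]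

theorem one_add_sq_div_two_le_cosh (x : ℝ) : 1 + x ^ 2 / 2 ≤ Real.cosh x := by
  have h1 : Real.cosh x = 1 + 2 * Real.sinh (x / 2) ^ 2 := by
    have := Real.cosh_two_mul (x / 2)
    rw [mul_div_cancel₀ x two_ne_zero] at this
    linarith [Real.cosh_sq (x / 2)]
  have h2 : (x / 2) ^ 2 ≤ Real.sinh (x / 2) ^ 2 := by
    rw [← sq_abs, ← sq_abs (Real.sinh _), Real.abs_sinh]
    have := Real.self_le_sinh_iff.2 (abs_nonneg (x / 2))
    gcongr
  nlinarith

theorem cosh_add_int_mul_pi_mul_I (z : ℂ) (k : ℤ) :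
    Complex.cosh (z + k * Real.pi * I) = Complex.cosh z ∨
      Complex.cosh (z + k * Real.pi * I) = -Complex.cosh z := by
  rw [Complex.cosh_add, Complex.cosh_mul_I, Complex.sinh_mul_I, Complex.sin_int_mul_pi]
  have h : Complex.cos (k * Real.pi) = 1 ∨ Complex.cos (k * Real.pi) = -1 := by
    rw [← sq_eq_one_iff]
    simpa [Complex.sin_int_mul_pi] using Complex.sin_sq_add_cos_sq (k * Real.pi)
  rcases h with h | h <;> simp [h]

theorem iterate_cosh_conj (n : ℕ) (z : ℂ) :
    Complex.cosh^[n] (conj z) = conj (Complex.cosh^[n] z) :=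
  (Function.Semiconj.iterate_right (f := (conj : ℂ → ℂ)) (fun w => (Complex.cosh_conj w).symm) n
    z).symm

theorem mem_coshRealPreimage_succ {n : ℕ} {z : ℂ} :
    z ∈ coshRealPreimage (n + 1) ↔ Complex.cosh z ∈ coshRealPreimage n := Iff.rfl

theorem coshRealPreimage_subset_succ (n : ℕ) :
    coshRealPreimage n ⊆ coshRealPreimage (n + 1) := by
  intro z hz
  have hz : (Complex.cosh^[n] z).im = 0 := hz
  change (Complex.cosh^[n + 1] z).im = 0
  rw [Function.iterate_succ_apply', cosh_im_eq, hz]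
  simp

theorem conj_mem_coshRealPreimage {n : ℕ} {z : ℂ} :
    conj z ∈ coshRealPreimage n ↔ z ∈ coshRealPreimage n := by
  simp [coshRealPreimage, iterate_cosh_conj]

theorem neg_mem_coshRealPreimage {n : ℕ} {z : ℂ} :
    -z ∈ coshRealPreimage n ↔ z ∈ coshRealPreimage n := by
  cases n with
  | zero => simp [coshRealPreimage]
  | succ n => rw [mem_coshRealPreimage_succ, mem_coshRealPreimage_succ, Complex.cosh_neg]

theorem add_int_mul_pi_mul_I_mem_coshRealPreimage {n : ℕ} {z : ℂ} (k : ℤ) :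
    z + k * Real.pi * I ∈ coshRealPreimage (n + 1) ↔ z ∈ coshRealPreimage (n + 1) := by
  rw [mem_coshRealPreimage_succ, mem_coshRealPreimage_succ]
  rcases cosh_add_int_mul_pi_mul_I z k with h | h <;> rw [h]
  exact neg_mem_coshRealPreimage

theorem zero_mem_coshRealPreimage (n : ℕ) : (0 : ℂ) ∈ coshRealPreimage n := by
  induction n with
  | zero => simp [coshRealPreimage]
  | succ n ih => exact coshRealPreimage_subset_succ n ih

theorem injective_cosh_closedHalfStrip :
    Function.Injective (fun z : closedHalfStrip => Complex.cosh z) := by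
  rintro ⟨z, hz1, hz2, hz3⟩ ⟨w, hw1, hw2, hw3⟩ h
  have hpi := Real.pi_pos
  simp only [← Complex.cos_mul_I] at h
  obtain ⟨k, hk⟩ := Complex.cos_eq_cos_iff.1 h
  have key : ∀ {s : ℝ}, w * I = 2 * k * Real.pi + s * (z * I) →
      w.re = s * z.re ∧ w.im = s * z.im - 2 * k * Real.pi := by
    intro s hs
    have h1 := congrArg Complex.re hs
    have h2 := congrArg Complex.im hs
    simp at h1 h2
    constructor <;> linarith
  apply Subtype.ext
  change z = w
  rcases hk with hk | hk
  · obtain ⟨h1, h2⟩ := key (s := 1) (by simpa using hk)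
    have hk0 : k = 0 := by
      have ha : (-1 : ℝ) < k := by nlinarith
      have hb : (k : ℝ) < 1 := by nlinarith
      have ha' : -1 < k := by exact_mod_cast ha
      have hb' : k < 1 := by exact_mod_cast hb
      omega
    subst hk0
    apply Complex.ext <;> simp_all
  · obtain ⟨h1, h2⟩ := key (s := -1) (by rw [hk]; push_cast; ring)
    have hre : z.re = 0 ∧ w.re = 0 := by constructor <;> linarith
    have hk0 : k = 0 ∨ k = -1 := by
      have ha : (-2 : ℝ) < k := by nlinarith
      have hb : (k : ℝ) < 1 := by nlinarith
      have ha' : -2 < k := by exact_mod_cast ha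
      have hb' : k < 1 := by exact_mod_cast hb
      omega
    apply Complex.ext
    · rw [hre.1, hre.2]
    · rcases hk0 with rfl | rfl <;> push_cast at h2 <;> linarith

theorem isClosed_closedHalfStrip : IsClosed closedHalfStrip := by
  refine (isClosed_le continuous_const Complex.continuous_re).inter
    ((isClosed_le continuous_const Complex.continuous_im).inter
      (isClosed_le Complex.continuous_im continuous_const))

theorem isClosedMap_cosh_closedHalfStrip :
    IsClosedMap (fun z : closedHalfStrip => Complex.cosh z) := by
  have hcont : Continuous (fun z : closedHalfStrip => Complex.cosh z) :=
    Complex.continuous_cosh.comp continuous_subtype_val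
  refine IsProperMap.isClosedMap (isProperMap_iff_tendsto_cocompact.2 ⟨hcont, ?_⟩)
  rw [← Metric.cobounded_eq_cocompact (α := ℂ), ← comap_norm_atTop, tendsto_comap_iff]
  have h1 : Tendsto (fun z : closedHalfStrip => ‖(z : ℂ)‖ - Real.pi)
      (cocompact closedHalfStrip) atTop := by
    refine tendsto_atTop_add_const_right _ _ ?_
    exact tendsto_norm_cocompact_atTop.comp
      isClosed_closedHalfStrip.isClosedEmbedding_subtypeVal.tendsto_cocompact
  refine tendsto_atTop_mono ?_ h1
  rintro ⟨z, hz1, hz2, hz3⟩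
  have h2 : ‖z‖ ≤ z.re + Real.pi := by
    refine (Complex.norm_le_abs_re_add_abs_im z).trans ?_
    rw [abs_of_nonneg hz1, abs_of_nonneg hz2]
    linarith
  have h3 : z.re ≤ ‖Complex.cosh z‖ := by
    refine abs_le_of_sq_le_sq' ?_ (norm_nonneg _) |>.2
    rw [← Complex.normSq_eq_norm_sq, Complex.normSq_apply, cosh_re_eq, cosh_im_eq]
    have h4 := Real.self_le_sinh_iff.2 hz1
    nlinarith [Real.cosh_sq z.re, Real.sin_sq_add_cos_sq z.im, sq_nonneg (Real.cos z.im)]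
  change ‖z‖ - Real.pi ≤ ‖Complex.cosh z‖
  linarith

theorem exists_eq_add_int_mul_pi_mul_I {z : ℂ} (hz : 0 ≤ z.re) :
    ∃ b ∈ closedHalfStrip, ∃ k : ℤ, z = b + k * Real.pi * I := by
  have hpi := Real.pi_pos
  refine ⟨z - ⌊z.im / Real.pi⌋ * Real.pi * I, ⟨?_, ?_, ?_⟩, ⌊z.im / Real.pi⌋, by ring⟩
  · simpa using hz
  · have := (le_div_iff₀ hpi).1 (Int.floor_le (z.im / Real.pi))
    simpa using this
  · have := (div_lt_iff₀ hpi).1 (Int.lt_floor_add_one (z.im / Real.pi))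
    simp
    linarith

theorem exists_eq_add_or_eq_neg_add (z : ℂ) :
    ∃ b ∈ closedHalfStrip, ∃ k : ℤ, z = b + k * Real.pi * I ∨ z = -b + k * Real.pi * I := by
  rcases le_total 0 z.re with h | h
  · obtain ⟨b, hb, k, hk⟩ := exists_eq_add_int_mul_pi_mul_I h
    exact ⟨b, hb, k, Or.inl hk⟩
  · obtain ⟨b, hb, k, hk⟩ := exists_eq_add_int_mul_pi_mul_I (z := -z) (by simpa using h)
    refine ⟨b, hb, -k, Or.inr ?_⟩
    rw [← neg_neg z, hk]
    push_cast
    ring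

theorem closedUpperHalfPlane_subset_range_cosh {w : ℂ} (hw : 0 ≤ w.im) :
    w ∈ range (fun z : closedHalfStrip => Complex.cosh z) := by
  obtain ⟨z, rfl⟩ : ∃ z, Complex.cosh z = w := by
    obtain ⟨u, hu⟩ := Complex.cos_surjective w
    exact ⟨u * I, by rw [Complex.cosh_mul_I, hu]⟩
  obtain ⟨b, hb, k, hk⟩ := exists_eq_add_or_eq_neg_add z
  have hzb : Complex.cosh z = Complex.cosh b ∨ Complex.cosh z = -Complex.cosh b := by
    rcases hk with rfl | rfl
    · exact cosh_add_int_mul_pi_mul_I b k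
    · rw [← Complex.cosh_neg b]
      exact cosh_add_int_mul_pi_mul_I (-b) k
  rcases hzb with h | h
  · exact ⟨⟨b, hb⟩, h.symm⟩
  · have hpos : 0 ≤ (Complex.cosh b).im := by
      rw [cosh_im_eq]
      exact mul_nonneg (Real.sinh_nonneg_iff.2 hb.1)
        (Real.sin_nonneg_of_nonneg_of_le_pi hb.2.1 hb.2.2)
    have him : (Complex.cosh b).im = 0 := by
      rw [h, Complex.neg_im] at hw
      linarith
    have hc : (conj b + Real.pi * I).re = b.re ∧ (conj b + Real.pi * I).im = Real.pi - b.im := by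
      constructor <;> simp
      ring
    refine ⟨⟨conj b + Real.pi * I, ?_, ?_, ?_⟩, ?_⟩
    · rw [hc.1]; exact hb.1
    · rw [hc.2]; linarith [hb.2.2]
    · rw [hc.2]; linarith [hb.2.1]
    · apply Complex.ext
      · simp only [cosh_re_eq, h, Complex.neg_re, hc.1, hc.2, Real.cos_pi_sub]
        ring
      · simp only [h, Complex.neg_im, him, cosh_im_eq, hc.1, hc.2, Real.sin_pi_sub]
        rw [← cosh_im_eq, him, neg_zero]

theorem isPreconnected_coshRealPreimage_inter_upper {n : ℕ}
    (h : IsPreconnected (coshRealPreimage n)) :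
    IsPreconnected (coshRealPreimage n ∩ {z | 0 ≤ z.im}) := by
  have himg : (fun z : ℂ => (z.re : ℂ) + |z.im| * I) '' coshRealPreimage n =
      coshRealPreimage n ∩ {z | 0 ≤ z.im} := by
    ext w
    constructor
    · rintro ⟨z, hz, rfl⟩
      refine ⟨?_, by simp⟩
      rcases abs_choice z.im with h | h
      · simpa only [h, Complex.re_add_im] using hz
      · have : (z.re : ℂ) + |z.im| * I = conj z := by
          rw [h]
          apply Complex.ext <;> simp
        simpa only [this] using conj_mem_coshRealPreimage.2 hz
    · rintro ⟨hw, hw0⟩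
      refine ⟨w, hw, ?_⟩
      have hw0 : 0 ≤ w.im := hw0
      simp only [abs_of_nonneg hw0, Complex.re_add_im]
  rw [← himg]
  exact h.image _ (by fun_prop)

theorem isPreconnected_coshRealPreimage_inter_closedHalfStrip {n : ℕ}
    (h : IsPreconnected (coshRealPreimage n)) :
    IsPreconnected (coshRealPreimage (n + 1) ∩ closedHalfStrip) := by
  have h1 := (isPreconnected_coshRealPreimage_inter_upper h).preimage_of_isClosedMap
    injective_cosh_closedHalfStrip isClosedMap_cosh_closedHalfStrip
    (fun w hw => closedUpperHalfPlane_subset_range_cosh hw.2)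
  convert h1.image Subtype.val continuous_subtype_val.continuousOn using 1
  ext z
  constructor
  · rintro ⟨hz, hzs⟩
    refine ⟨⟨z, hzs⟩, ⟨hz, ?_⟩, rfl⟩
    change 0 ≤ (Complex.cosh z).im
    rw [cosh_im_eq]
    exact mul_nonneg (Real.sinh_nonneg_iff.2 hzs.1)
      (Real.sin_nonneg_of_nonneg_of_le_pi hzs.2.1 hzs.2.2)
  · rintro ⟨⟨w, hws⟩, ⟨hw, -⟩, rfl⟩
    exact ⟨hw, hws⟩

theorem isPreconnected_coshRealPreimage (n : ℕ) : IsPreconnected (coshRealPreimage n) := by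
  induction n with
  | zero =>
    have : coshRealPreimage 0 = Complex.imLm ⁻¹' {0} := by ext; simp [coshRealPreimage]
    rw [this]
    exact ((convex_singleton (0 : ℝ)).linear_preimage Complex.imLm).isPreconnected
  | succ n ih =>
    have hB := isPreconnected_coshRealPreimage_inter_closedHalfStrip ih
    have hpi := Real.pi_pos
    set B := coshRealPreimage (n + 1) ∩ closedHalfStrip
    have h0 : (0 : ℂ) ∈ B := ⟨zero_mem_coshRealPreimage _, by simp [closedHalfStrip, hpi.le]⟩
    have h1 : (Real.pi * I : ℂ) ∈ B := by
      refine ⟨?_, by simp [closedHalfStrip, hpi.le]⟩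
      simpa using (add_int_mul_pi_mul_I_mem_coshRealPreimage (z := 0) 1).2
        (zero_mem_coshRealPreimage (n + 1))
    let C : ℤ → Set ℂ := fun k =>
      (fun z => z + k * Real.pi * I) '' B ∪ (fun z => -z + k * Real.pi * I) '' B
    have hC : ∀ k, IsPreconnected (C k) := fun k =>
      (hB.image _ (by fun_prop)).union (k * Real.pi * I) ⟨0, h0, by simp⟩ ⟨0, h0, by simp⟩
        (hB.image _ (by fun_prop))
    have hU : coshRealPreimage (n + 1) = ⋃ k, C k := by
      ext z
      rw [mem_iUnion]
      constructor
      · intro hz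
        obtain ⟨b, hb, k, rfl | rfl⟩ := exists_eq_add_or_eq_neg_add z
        · exact ⟨k, Or.inl ⟨b, ⟨(add_int_mul_pi_mul_I_mem_coshRealPreimage k).1 hz, hb⟩, rfl⟩⟩
        · exact ⟨k, Or.inr ⟨b, ⟨neg_mem_coshRealPreimage.1
            ((add_int_mul_pi_mul_I_mem_coshRealPreimage k).1 hz), hb⟩, rfl⟩⟩
      · rintro ⟨k, ⟨b, hb, rfl⟩ | ⟨b, hb, rfl⟩⟩
        · exact (add_int_mul_pi_mul_I_mem_coshRealPreimage k).2 hb.1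
        · exact (add_int_mul_pi_mul_I_mem_coshRealPreimage k).2
            (neg_mem_coshRealPreimage.2 hb.1)
    rw [hU]
    refine IsPreconnected.iUnion_of_chain hC fun k => ?_
    refine ⟨Real.pi * I + k * Real.pi * I, Or.inl ⟨_, h1, rfl⟩, Or.inl ⟨0, h0, ?_⟩⟩
    simp
    ring

theorem isPreconnected_iUnion_coshRealPreimage :
    IsPreconnected (⋃ n, coshRealPreimage n) :=
  isPreconnected_iUnion ⟨0, mem_iInter.2 zero_mem_coshRealPreimage⟩
    isPreconnected_coshRealPreimage

/-- The Schwarz-Pick inequality at the centre of a disc mapped into a half-plane bounded by `ℝ`. -/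
theorem norm_deriv_mul_le_two_mul_abs_im {g : ℂ → ℂ} {c : ℂ} {r : ℝ} (hr : 0 < r)
    (hg : DifferentiableOn ℂ g (Metric.ball c r))
    (him : ∀ w ∈ Metric.ball c r, 0 < (g w).im * (g c).im) :
    ‖deriv g c‖ * r ≤ 2 * |(g c).im| := by
  have hc : c ∈ Metric.ball c r := Metric.mem_ball_self hr
  have hne : ∀ w ∈ Metric.ball c r, g w - conj (g c) ≠ 0 := by
    intro w hw h
    have h1 := congrArg Complex.im h
    simp at h1
    have h2 := him w hw
    rw [eq_neg_of_add_eq_zero_left h1] at h2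
    nlinarith [sq_nonneg (g c).im]
  have hd := (hg.sub_const (g c)).div (hg.sub_const (conj (g c))) hne
  have hmaps : MapsTo ((fun w => g w - g c) / fun w => g w - conj (g c)) (Metric.ball c r)
      (Metric.closedBall (((fun w => g w - g c) / fun w => g w - conj (g c)) c) 1) := by
    intro w hw
    have h1 := norm_pos_iff.2 (hne w hw)
    simp only [Pi.div_apply, sub_self, zero_div, mem_closedBall_zero_iff, norm_div]
    rw [div_le_one h1]
    refine abs_le_of_sq_le_sq' ?_ h1.le |>.2
    rw [← Complex.normSq_eq_norm_sq, ← Complex.normSq_eq_norm_sq, Complex.normSq_apply,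
      Complex.normSq_apply]
    simp
    nlinarith [him w hw]
  have hdiff : HasDerivAt g (deriv g c) c :=
    (hg.differentiableAt (Metric.isOpen_ball.mem_nhds hc)).hasDerivAt
  have hderiv := ((hdiff.sub_const (g c)).div (hdiff.sub_const (conj (g c))) (hne c hc)).deriv
  have hle := Complex.norm_deriv_le_div_of_mapsTo_ball hd hmaps hr
  rw [hderiv, sub_self, zero_mul, sub_zero, Complex.sub_conj, norm_div, norm_mul, norm_pow] at hle
  have hn : ‖((2 * (g c).im : ℝ) : ℂ) * I‖ = 2 * |(g c).im| := by simp
  rw [hn] at hle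
  have hpos : 0 < 2 * |(g c).im| := by
    have : (g c).im ≠ 0 := fun h => by simpa [h] using him c hc
    positivity
  rw [div_le_div_iff₀ (by positivity) hr] at hle
  nlinarith

theorem sq_le_of_sq_le_mul_sin_sq {ε y : ℝ} (hε : 0 ≤ ε) (h : y ^ 2 ≤ (1 + ε) * Real.sin y ^ 2) :
    y ^ 2 ≤ 4 * ε * (1 + ε) := by
  have h1 : Real.sin y = 2 * Real.sin (y / 2) * Real.cos (y / 2) := by
    rw [← Real.sin_two_mul, mul_div_cancel₀ y two_ne_zero]
  have h2 := Real.sin_sq_le_sq (x := y / 2)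
  have h3 := Real.sin_sq_add_cos_sq (y / 2)
  set s := Real.sin (y / 2) ^ 2
  set c := Real.cos (y / 2) ^ 2
  have h4 : Real.sin y ^ 2 = 4 * s * c := by rw [h1]; ring
  have hs0 : 0 ≤ s := sq_nonneg _
  have hc0 : 0 ≤ c := sq_nonneg _
  rw [h4] at h
  rcases hs0.eq_or_lt with hs' | hs'
  · rw [← hs'] at h
    nlinarith [mul_nonneg hε hε]
  have h5 : 1 ≤ (1 + ε) * c := by
    have : 4 * s * 1 ≤ 4 * s * ((1 + ε) * c) := by nlinarith
    exact le_of_mul_le_mul_left this (by linarith)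
  have h6 : s ≤ ε := by nlinarith
  nlinarith [mul_nonneg hε hε, mul_nonneg (add_nonneg zero_le_one hε) hs0]

/-- A nonreal orbit of `x + iy ↦ cosh (x + iy)` cannot remain in a narrow region around `ℝ`
that pinches at the origin. -/
theorem not_eventually_near_real {x y : ℕ → ℝ}
    (hx : ∀ n, x (n + 1) = Real.cosh (x n) * Real.cos (y n))
    (hy : ∀ n, y (n + 1) = Real.sinh (x n) * Real.sin (y n)) (hy0 : ∀ n, y n ≠ 0) {N : ℕ}
    (hN : ∀ n ≥ N, y n ^ 2 ≤ (1 + 1 / 1000) * Real.sin (y n) ^ 2 ∧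
      y n ^ 2 ≤ 1 / 1000 * Real.sinh (x n) ^ 2) : False := by
  have hsmall : ∀ n ≥ N, y n ^ 2 ≤ 1 / 100 := fun n hn => by
    have := sq_le_of_sq_le_mul_sin_sq (by norm_num) (hN n hn).1
    linarith
  have hcos : ∀ n ≥ N, 99 / 100 ≤ Real.cos (y n) ^ 2 := fun n hn => by
    nlinarith [hsmall n hn, Real.sin_sq_le_sq (x := y n), Real.sin_sq_add_cos_sq (y n)]
  have hx1 : ∀ n ≥ N, 1 ≤ x (n + 1) ^ 2 := fun n hn => by
    rw [hx, mul_pow, Real.cosh_sq]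
    have h1 := (hN n hn).2
    have h2 : 1 - y n ^ 2 ≤ Real.cos (y n) ^ 2 := by
      nlinarith [Real.sin_sq_le_sq (x := y n), Real.sin_sq_add_cos_sq (y n)]
    have h3 := hsmall n hn
    have h4 := sq_nonneg (y n)
    calc (1 : ℝ) ≤ (1000 * y n ^ 2 + 1) * (1 - y n ^ 2) := by nlinarith
      _ ≤ _ := by
        have : 1000 * y n ^ 2 ≤ Real.sinh (x n) ^ 2 := by linarith
        gcongr
        linarith
  have hx2 : ∀ n ≥ N, 2 ≤ x (n + 2) ^ 2 := fun n hn => by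
    rw [hx (n + 1), mul_pow]
    have h1 := one_add_sq_div_two_le_cosh (x (n + 1))
    have h2 := hcos (n + 1) (by omega)
    have h3 := hx1 n hn
    have h4 : (3 / 2) ^ 2 ≤ Real.cosh (x (n + 1)) ^ 2 := by
      have : 3 / 2 ≤ Real.cosh (x (n + 1)) := by linarith
      gcongr
    nlinarith
  have hgrow : ∀ n ≥ N, 3 / 2 * y (n + 2) ^ 2 ≤ y (n + 2 + 1) ^ 2 := fun n hn => by
    rw [hy (n + 2), mul_pow]
    have h1 : x (n + 2) ^ 2 ≤ Real.sinh (x (n + 2)) ^ 2 := by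
      rw [← sq_abs, ← sq_abs (Real.sinh _), Real.abs_sinh]
      have := Real.self_le_sinh_iff.2 (abs_nonneg (x (n + 2)))
      gcongr
    have h2 := (hN (n + 2) (by omega)).1
    have h3 := hx2 n hn
    nlinarith [sq_nonneg (Real.sin (y (n + 2)))]
  have hpow : ∀ k, (3 / 2 : ℝ) ^ k * y (N + 2) ^ 2 ≤ y (N + k + 2) ^ 2 := by
    intro k
    induction k with
    | zero => simp
    | succ k ih =>
      have := hgrow (N + k) (by omega)
      rw [show N + (k + 1) + 2 = N + k + 2 + 1 by ring, pow_succ]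
      linarith
  have hpos : 0 < y (N + 2) ^ 2 := by have := hy0 (N + 2); positivity
  obtain ⟨k, hk⟩ := pow_unbounded_of_one_lt (1 / y (N + 2) ^ 2) (by norm_num : (1 : ℝ) < 3 / 2)
  rw [div_lt_iff₀ hpos] at hk
  linarith [hpow k, hsmall (N + k + 2) (by omega)]

theorem differentiable_iterate_cosh (n : ℕ) : Differentiable ℂ (Complex.cosh^[n]) :=
  Complex.differentiable_cosh.iterate n

theorem deriv_iterate_cosh_succ (n : ℕ) (z : ℂ) :
    deriv (Complex.cosh^[n + 1]) z =
      Complex.sinh (Complex.cosh^[n] z) * deriv (Complex.cosh^[n]) z := by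
  rw [Function.iterate_succ',
    deriv_comp z Complex.differentiableAt_cosh (differentiable_iterate_cosh n z),
    Complex.deriv_cosh]

theorem dense_iUnion_coshRealPreimage : Dense (⋃ n, coshRealPreimage n) := by
  rw [Metric.dense_iff]
  intro c r hr
  by_contra hempty
  rw [Set.not_nonempty_iff_eq_empty] at hempty
  have hball : ∀ w ∈ Metric.ball c r, ∀ n, (Complex.cosh^[n] w).im ≠ 0 := fun w hw n h =>
    (Set.eq_empty_iff_forall_notMem.1 hempty w) ⟨hw, mem_iUnion.2 ⟨n, h⟩⟩
  have hc : c ∈ Metric.ball c r := Metric.mem_ball_self hr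
  have hsign : ∀ n, ∀ w ∈ Metric.ball c r,
      0 < (Complex.cosh^[n] w).im * (Complex.cosh^[n] c).im := by
    intro n w hw
    by_contra! hneg
    have hcont : Continuous fun w => (Complex.cosh^[n] w).im * (Complex.cosh^[n] c).im :=
      (Complex.continuous_im.comp (differentiable_iterate_cosh n).continuous).mul_const _
    obtain ⟨v, hv, hv0⟩ := (convex_ball c r).isPreconnected.intermediate_value hw hc
      hcont.continuousOn ⟨hneg, mul_self_nonneg _⟩
    exact (mul_ne_zero (hball v hv n) (hball c hc n)) hv0
  set x : ℕ → ℝ := fun n => (Complex.cosh^[n] c).re with hxdef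
  set y : ℕ → ℝ := fun n => (Complex.cosh^[n] c).im with hydef
  have hx : ∀ n, x (n + 1) = Real.cosh (x n) * Real.cos (y n) := fun n => by
    simp only [hxdef, hydef, Function.iterate_succ_apply', cosh_re_eq]
  have hy : ∀ n, y (n + 1) = Real.sinh (x n) * Real.sin (y n) := fun n => by
    simp only [hxdef, hydef, Function.iterate_succ_apply', cosh_im_eq]
  have hy0 : ∀ n, y n ≠ 0 := hball c hc
  have hsinh : ∀ n, 0 < Real.sinh (x n) ^ 2 := fun n => by
    have := left_ne_zero_of_mul (hy n ▸ hy0 (n + 1))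
    positivity
  have hsin : ∀ n, 0 < Real.sin (y n) ^ 2 := fun n => by
    have := right_ne_zero_of_mul (hy n ▸ hy0 (n + 1))
    positivity
  have hysq : ∀ n, 0 < y n ^ 2 := fun n => by have := hy0 n; positivity
  set d : ℕ → ℝ := fun n => ‖deriv (Complex.cosh^[n]) c‖ ^ 2 with hddef
  have hd : ∀ n, d (n + 1) = (Real.sinh (x n) ^ 2 + Real.sin (y n) ^ 2) * d n := fun n => by
    simp only [hddef, hxdef, hydef, deriv_iterate_cosh_succ, norm_mul, mul_pow, norm_sinh_sq]
  have hdpos : ∀ n, 0 < d n := by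
    intro n
    induction n with
    | zero => simp [hddef]
    | succ n ih =>
      rw [hd]
      exact mul_pos (add_pos (hsinh n) (hsin n)) ih
  -- `q n` is the square of the hyperbolic derivative of the `n`-th iterate, up to a constant.
  set q : ℕ → ℝ := fun n => d n / y n ^ 2 with hqdef
  have hqpos : ∀ n, 0 < q n := fun n => div_pos (hdpos n) (hysq n)
  have hq : ∀ n, q (n + 1) * (Real.sinh (x n) ^ 2 * Real.sin (y n) ^ 2) =
      q n * ((Real.sinh (x n) ^ 2 + Real.sin (y n) ^ 2) * y n ^ 2) := fun n => by
    have h1 := left_ne_zero_of_mul (hy n ▸ hy0 (n + 1))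
    have h2 := right_ne_zero_of_mul (hy n ▸ hy0 (n + 1))
    have h3 := hy0 n
    simp only [hqdef, hd, hy, mul_pow]
    field_simp
  have hmono : Monotone q := by
    refine monotone_nat_of_le_succ fun n => ?_
    have h1 := mul_pos (hsinh n) (hsin n)
    refine le_of_mul_le_mul_right ?_ h1
    rw [hq n]
    refine mul_le_mul_of_nonneg_left ?_ (hqpos n).le
    nlinarith [Real.sin_sq_le_sq (x := y n), mul_pos (hsin n) (hysq n), hsinh n]
  have hbdd : BddAbove (range q) := by
    refine ⟨4 / r ^ 2, ?_⟩
    rintro _ ⟨n, rfl⟩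
    have h1 := norm_deriv_mul_le_two_mul_abs_im hr
      (differentiable_iterate_cosh n).differentiableOn (hsign n)
    have h2 := pow_le_pow_left₀ (by positivity) h1 2
    rw [mul_pow, mul_pow, sq_abs] at h2
    change d n / y n ^ 2 ≤ _
    rw [div_le_div_iff₀ (hysq n) (by positivity)]
    change d n * r ^ 2 ≤ 2 ^ 2 * y n ^ 2 at h2
    linarith
  have hL : 0 < ⨆ n, q n := (hqpos 0).trans_le (le_ciSup hbdd 0)
  obtain ⟨N, hN⟩ := exists_lt_of_lt_ciSup
    (show (⨆ n, q n) / (1 + 1 / 1000) < ⨆ n, q n from div_lt_self hL (by norm_num))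
  rw [div_lt_iff₀ (by norm_num)] at hN
  refine not_eventually_near_real hx hy hy0 (N := N) fun n hn => ?_
  have hratio : q (n + 1) ≤ q n * (1 + 1 / 1000) :=
    (le_ciSup hbdd (n + 1)).trans (hN.le.trans (by gcongr; exact hmono hn))
  have hkey : (Real.sinh (x n) ^ 2 + Real.sin (y n) ^ 2) * y n ^ 2 ≤
      (1 + 1 / 1000) * (Real.sinh (x n) ^ 2 * Real.sin (y n) ^ 2) := by
    refine le_of_mul_le_mul_left ?_ (hqpos n)
    rw [← hq n, ← mul_assoc (q n)]
    exact mul_le_mul_of_nonneg_right hratio (mul_pos (hsinh n) (hsin n)).le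
  constructor
  · refine le_of_mul_le_mul_left ?_ (hsinh n)
    nlinarith [mul_pos (hsin n) (hysq n)]
  · refine le_of_mul_le_mul_left ?_ (hsin n)
    nlinarith [mul_le_mul_of_nonneg_left (Real.sin_sq_le_sq (x := y n)) (hsinh n).le]

theorem tendsto_re_iterate_cosh_of_im_eq_zero {z : ℂ} (hz : z.im = 0) :
    Tendsto (fun n => (Complex.cosh^[n] z).re) atTop atTop := by
  have him : ∀ n, (Complex.cosh^[n] z).im = 0 := by
    intro n
    induction n with
    | zero => exact hz
    | succ n ih => rw [Function.iterate_succ_apply', cosh_im_eq, ih]; simp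
  have hlow : ∀ n : ℕ, z.re + n * (1 / 2) ≤ (Complex.cosh^[n] z).re := by
    intro n
    induction n with
    | zero => simp
    | succ n ih =>
      rw [Function.iterate_succ_apply', cosh_re_eq, him n, Real.cos_zero, mul_one]
      push_cast
      nlinarith [one_add_sq_div_two_le_cosh (Complex.cosh^[n] z).re,
        sq_nonneg ((Complex.cosh^[n] z).re - 1)]
  exact tendsto_atTop_mono hlow (tendsto_atTop_add_const_left _ _
    (tendsto_natCast_atTop_atTop.atTop_mul_const (by norm_num)))

theorem tendsto_re_iterate_cosh {z : ℂ} (hz : z ∈ ⋃ n, coshRealPreimage n) :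
    Tendsto (fun n => (Complex.cosh^[n] z).re) atTop atTop := by
  obtain ⟨m, hm⟩ := mem_iUnion.1 hz
  rw [← tendsto_add_atTop_iff_nat m]
  simpa only [Function.iterate_add_apply] using tendsto_re_iterate_cosh_of_im_eq_zero hm

/-- For `f(z) = exp((z + 1/z)/2)`: `f` is a transcendental self-map of
`ℂ*`, the set `I_∞(f) = {z : |fⁿ(z)| → ∞}` is connected, and `I(f)` is connected. Moreover
`cosh` is a lift of `f` and the escaping set of the entire function `cosh` is connected. -/
theorem example_I_infty_connected (f : ℂ → ℂ)
    (hf : ∀ z : ℂ, f z = Complex.exp ((z + z⁻¹) / 2)) :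
    IsTranscendentalSelfMapCStar f ∧
    IsConnected {z : ℂ | z ≠ 0 ∧ Tendsto (fun n : ℕ => ‖f^[n] z‖) atTop atTop} ∧
    IsConnected (escapingSet f) ∧
    (∀ z : ℂ, Complex.exp (Complex.cosh z) = f (Complex.exp z)) ∧
    IsConnected {z : ℂ | Tendsto (fun n : ℕ => ‖Complex.cosh^[n] z‖) atTop atTop} := by
  have hsemi : Function.Semiconj Complex.exp Complex.cosh f := fun z => by
    rw [hf, ← Complex.exp_neg]
    rfl
  have hiter : ∀ n z, f^[n] (Complex.exp z) = Complex.exp (Complex.cosh^[n] z) := fun n z =>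
    (hsemi.iterate_right n z).symm
  set G := ⋃ n, coshRealPreimage n
  have h0 : (0 : ℂ) ∈ G := mem_iUnion.2 ⟨0, zero_mem_coshRealPreimage 0⟩
  have hexpG : IsPreconnected (Complex.exp '' G) :=
    isPreconnected_iUnion_coshRealPreimage.image _ Complex.continuous_exp.continuousOn
  have hexpI : Complex.exp '' G ⊆
      {z : ℂ | z ≠ 0 ∧ Tendsto (fun n : ℕ => ‖f^[n] z‖) atTop atTop} := by
    rintro _ ⟨z, hz, rfl⟩
    refine ⟨Complex.exp_ne_zero z, ?_⟩
    simp only [hiter, Complex.norm_exp]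
    exact Real.tendsto_exp_atTop.comp (tendsto_re_iterate_cosh hz)
  have hclosure : {z : ℂ | z ≠ 0} ⊆ closure (Complex.exp '' G) := by
    intro z hz
    rw [← Complex.exp_log hz]
    exact image_closure_subset_closure_image Complex.continuous_exp
      ⟨_, dense_iUnion_coshRealPreimage _, rfl⟩
  have hIinf : {z : ℂ | z ≠ 0 ∧ Tendsto (fun n : ℕ => ‖f^[n] z‖) atTop atTop} ⊆
      escapingSet f := by
    rintro z ⟨hz, ht⟩
    refine ⟨hz, fun ε _ => ?_⟩
    obtain ⟨N, hN⟩ := eventually_atTop.1 (ht.eventually_gt_atTop (1 / ε))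
    exact ⟨N, fun n hn => Or.inr (hN n hn)⟩
  have hne : (Complex.exp '' G).Nonempty := ⟨_, 0, h0, rfl⟩
  refine ⟨?_, ⟨hne.mono hexpI, hexpG.subset_closure hexpI fun z hz => hclosure hz.1⟩,
    ⟨hne.mono (hexpI.trans hIinf),
      hexpG.subset_closure (hexpI.trans hIinf) fun z hz => hclosure hz.1⟩, hsemi, ?_⟩
  · have hconst : ¬ ∃ c : ℂ, ∀ z : ℂ, z / 2 = c := by
      rintro ⟨c, hc⟩
      simpa using (hc 2).trans (hc 0).symm
    refine ⟨0, fun z => z / 2, fun z => z / 2, by fun_prop, by fun_prop, hconst, hconst, ?_⟩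
    intro z _
    rw [hf, zpow_zero, one_mul, add_div]
  · have hsub : G ⊆ {z : ℂ | Tendsto (fun n : ℕ => ‖Complex.cosh^[n] z‖) atTop atTop} :=
      fun z hz => tendsto_atTop_mono (fun n => Complex.re_le_norm _) (tendsto_re_iterate_cosh hz)
    exact ⟨⟨0, hsub h0⟩, isPreconnected_iUnion_coshRealPreimage.subset_closure hsub
      fun z _ => dense_iUnion_coshRealPreimage z⟩
end
end
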